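/- arXiv:1105.5756 — 2 statements merged into one kernel-verified Lean document; each statement's English description precedes it below -/
import Mathlib

section
/- Let K be an algebraically closed field and 2 ≤ d < n, and assume either that K has characteristic 0 or that d = 3. The vanishing ideal I_{d−1,d,n} of the Kalman variety K_{d−1,d,n} is minimally generated by C(d,2)·C(n−d,2) homogeneous polynomials of degree 2 and C(d,2)·C(n−d+1,2) homogeneous polynomials of degree 3. Precisely: dim_K (I_{d−1,d,n})_2 − dim_K (A₊·I_{d−1,d,n})_2 = C(d,2)·C(n−d,2), dim_K (I_{d−1,d,n})_3 − dim_K (A₊·I_{d−1,d,n})_3 = C(d,2)·C(n−d+1,2), and dim_K (I_{d−1,d,n})_j − dim_K (A₊·I_{d−1,d,n})_j = 0 for every other j ≥ 0. Here C(a,b) denotes the binomial coefficient. -/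
set_option synthInstance.maxHeartbeats 1000000
set_option maxHeartbeats 4000000

open Matrix

/-- The span of the first `d` standard basis vectors of `K^n`. -/
def firstCoordsSubspace (K : Type*) [Field K] (n d : ℕ) : Submodule K (Fin n → K) where
  carrier := {v | ∀ i : Fin n, d ≤ (i : ℕ) → v i = 0}
  add_mem' := fun hv hw i hi => by simp [hv i hi, hw i hi]
  zero_mem' := fun i _ => rfl
  smul_mem' := fun c v hv i hi => by simp [hv i hi]

/-- The Kalman variety `K_{s,d,n}`: matrices having an `s`-dimensional invariant
subspace contained in the span `L` of the first `d` standard basis vectors. -/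
def kalmanSet (K : Type*) [Field K] (n d s : ℕ) : Set (Matrix (Fin n) (Fin n) K) :=
  {M | ∃ U : Submodule K (Fin n → K), U ≤ firstCoordsSubspace K n d ∧
    Module.finrank K U = s ∧ ∀ v ∈ U, M.mulVec v ∈ U}

/-- The upper-left `d × d` block `α` of an `n × n` matrix. -/
def alphaBlock {K : Type*} [Field K] {n : ℕ} (d : ℕ) (h : d ≤ n)
    (M : Matrix (Fin n) (Fin n) K) : Matrix (Fin d) (Fin d) K :=
  fun i j => M (Fin.castLE h i) (Fin.castLE h j)

/-- The lower-left `(n-d) × d` block `γ` of an `n × n` matrix. -/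
def gammaBlock {K : Type*} [Field K] {n : ℕ} (d : ℕ) (h : d ≤ n)
    (M : Matrix (Fin n) (Fin n) K) : Matrix (Fin (n - d)) (Fin d) K :=
  fun i j => M ⟨d + (i : ℕ), by have := i.isLt; omega⟩ (Fin.castLE h j)

/-- The reduced Kalman matrix: the `d(n-d) × d` matrix obtained by stacking
`γ, γα, γα², …, γα^{d-1}`; row `(k, i)` is row `i` of the block `γ * α^k`. -/
def redKalman {K : Type*} [Field K] {n : ℕ} (d : ℕ) (h : d ≤ n)
    (M : Matrix (Fin n) (Fin n) K) : Matrix (Fin d × Fin (n - d)) (Fin d) K :=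
  fun p j => (gammaBlock d h M * (alphaBlock d h M) ^ (p.1 : ℕ)) p.2 j

/-- The vanishing ideal of a set of `n × n` matrices, inside the polynomial
coordinate ring `A = K[x_{ij}]` of the matrix space. -/
def matVanishingIdeal (K : Type*) [Field K] (n : ℕ)
    (S : Set (Matrix (Fin n) (Fin n) K)) : Ideal (MvPolynomial (Fin n × Fin n) K) where
  carrier := {f | ∀ M ∈ S, MvPolynomial.eval (fun p => M p.1 p.2) f = 0}
  add_mem' := fun ha hb M hM => by simp [ha M hM, hb M hM]
  zero_mem' := fun M hM => by simp
  smul_mem' := fun c f hf M hM => by simp [smul_eq_mul, hf M hM]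

/-- The coordinate ring `A` of the space of `n × n` matrices. -/
abbrev MatCoordRing (K : Type*) [Field K] (n : ℕ) := MvPolynomial (Fin n × Fin n) K

/-- The vanishing ideal `I_{s,d,n}` of the Kalman variety. -/
noncomputable def kalmanIdeal (K : Type*) [Field K] (n d s : ℕ) :
    Ideal (MatCoordRing K n) :=
  matVanishingIdeal K n (kalmanSet K n d s)

/-- The irrelevant (maximal graded) ideal `A₊` of the polynomial ring,
generated by all the variables. -/
noncomputable def irrelevantIdeal (K : Type*) [Field K] (n : ℕ) :
    Ideal (MatCoordRing K n) :=
  Ideal.span (Set.range MvPolynomial.X)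

/-- The coordinate ring `O_{s,d,n} = A/I_{s,d,n}` of the Kalman variety. -/
abbrev KalmanCoordRing (K : Type*) [Field K] (n d s : ℕ) :=
  MatCoordRing K n ⧸ kalmanIdeal K n d s

/-- The degree-`j` graded piece of a (homogeneous) ideal `J ⊆ A`, as a
`K`-subspace of `A`. -/
noncomputable def gradedPiece (K : Type*) [Field K] (n : ℕ)
    (J : Ideal (MatCoordRing K n)) (j : ℕ) : Submodule K (MatCoordRing K n) :=
  Submodule.restrictScalars K J ⊓ MvPolynomial.homogeneousSubmodule (Fin n × Fin n) K j

/-- The number of minimal generators of degree `j` of a homogeneous ideal `J`: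
`dim_K J_j − dim_K (A₊·J)_j`. -/
noncomputable def minGens (K : Type*) [Field K] (n : ℕ)
    (J : Ideal (MatCoordRing K n)) (j : ℕ) : ℕ :=
  Module.finrank K (gradedPiece K n J j) -
    Module.finrank K (gradedPiece K n (irrelevantIdeal K n * J) j)

theorem finrank_firstCoordsSubspace (K : Type*) [Field K] {n d : ℕ} (h : d ≤ n) :
    Module.finrank K (firstCoordsSubspace K n d) = d := by
  have hinj : Function.Injective (Fin.castLE h) := Fin.castLE_injective h
  have hrange : LinearMap.range (Function.ExtendByZero.linearMap K (Fin.castLE h)) =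
      firstCoordsSubspace K n d := by
    ext v
    constructor
    · rintro ⟨w, rfl⟩ i hi
      refine Function.extend_apply' _ _ _ ?_
      rintro ⟨j, rfl⟩
      have := j.isLt
      simp at hi
      omega
    · intro hv
      refine ⟨v ∘ Fin.castLE h, ?_⟩
      ext i
      by_cases hi : (i : ℕ) < d
      · exact hinj.extend_apply _ _ (⟨i, hi⟩ : Fin d)
      · rw [hv i (not_lt.mp hi)]
        refine Function.extend_apply' _ _ _ ?_
        rintro ⟨j, rfl⟩
        exact hi j.isLt
  rw [← hrange, LinearMap.finrank_range_of_inj, Module.finrank_fin_fun]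
  intro v w hvw
  ext j
  have := congrFun hvw (Fin.castLE h j)
  simpa [Function.ExtendByZero.linearMap_apply, hinj.extend_apply] using this

/-- Two functionals vanishing on a hyperplane of the coordinate subspace are proportional on it. -/
theorem minor_eq_of_vanish_on_hyperplane {K : Type*} [Field K] {n d : ℕ} (hd : 2 ≤ d)
    (h : d ≤ n) {U : Submodule K (Fin n → K)} (hU : U ≤ firstCoordsSubspace K n d)
    (hfin : Module.finrank K U = d - 1) {a b : Fin n → K}
    (ha : ∀ u ∈ U, a ⬝ᵥ u = 0) (hb : ∀ u ∈ U, b ⬝ᵥ u = 0) {k l : Fin n}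
    (hk : (k : ℕ) < d) (hl : (l : ℕ) < d) : a k * b l = a l * b k := by
  by_cases hkl : k = l
  · subst hkl; ring
  set e : Fin 2 → Fin n → K := ![Pi.single k 1, Pi.single l 1] with he
  have hind : LinearIndependent K e := by
    rw [LinearIndependent.pair_iff]
    intro s t hst
    have h1 := congrFun hst k
    have h2 := congrFun hst l
    simp [hkl, Ne.symm hkl] at h1 h2
    exact ⟨h1, h2⟩
  have hW : Module.finrank K (Submodule.span K (Set.range e)) = 2 := by
    rw [finrank_span_eq_card hind]; simp
  have hWL : Submodule.span K (Set.range e) ≤ firstCoordsSubspace K n d := by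
    rw [Submodule.span_le]
    rintro _ ⟨i, rfl⟩ j hj
    have h1 : j ≠ k := by rintro rfl; omega
    have h2 : j ≠ l := by rintro rfl; omega
    fin_cases i <;> simp [he, h1, h2]
  have hsup : Module.finrank K (U ⊔ Submodule.span K (Set.range e) : Submodule K (Fin n → K)) ≤ d :=
    (Submodule.finrank_mono (sup_le hU hWL)).trans (finrank_firstCoordsSubspace K h).le
  have hdim := Submodule.finrank_sup_add_finrank_inf_eq U (Submodule.span K (Set.range e))
  have hne : U ⊓ Submodule.span K (Set.range e) ≠ ⊥ := by
    intro hbot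
    rw [hbot, finrank_bot, hfin, hW] at hdim
    omega
  obtain ⟨u, ⟨huU, huW⟩, hu0⟩ := Submodule.exists_mem_ne_zero_of_ne_bot hne
  have : Set.range e = {Pi.single k 1, Pi.single l 1} := by simp [he, Set.pair_comm]
  rw [this] at huW
  obtain ⟨x, y, rfl⟩ := Submodule.mem_span_pair.mp huW
  have h1 := ha _ huU
  have h2 := hb _ huU
  simp [dotProduct_add] at h1 h2
  by_cases hx : x = 0
  · have hy : y ≠ 0 := by
      rintro rfl
      exact hu0 (by simp [hx])
    have : a l = 0 := by simpa [hx, hy] using h1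
    have : b l = 0 := by simpa [hx, hy] using h2
    simp [*]
  · apply mul_left_cancel₀ hx
    linear_combination b l * h1 - a l * h2

/-- A matrix with lower-left block `v φ` and `φ` a left eigenvector of the upper-left block
lies in the Kalman variety. -/
theorem mem_kalmanSet_of_eigenvector {K : Type*} [Field K] {n d : ℕ} (h : d ≤ n)
    {M : Matrix (Fin n) (Fin n) K} {v φ : Fin n → K} {lam : K} {s : Fin n}
    (hs : (s : ℕ) < d) (hφs : φ s ≠ 0)
    (hγ : ∀ p q : Fin n, d ≤ (p : ℕ) → (q : ℕ) < d → M p q = v p * φ q)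
    (hα : ∀ q : Fin n, (q : ℕ) < d → ∑ r, φ r * M r q = lam * φ q) :
    M ∈ kalmanSet K n d (d - 1) := by
  set ev : (Fin n → K) →ₗ[K] K := dotProductBilin K K φ with hev
  have hev' : ∀ u, ev u = φ ⬝ᵥ u := fun u => rfl
  set g := ev.comp (firstCoordsSubspace K n d).subtype with hg
  have hdot : ∀ a u : Fin n → K, u ∈ firstCoordsSubspace K n d →
      ∀ c : K, (∀ q : Fin n, (q : ℕ) < d → a q = c * φ q) → a ⬝ᵥ u = c * (φ ⬝ᵥ u) := by
    intro a u hu c hac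
    simp only [dotProduct, Finset.mul_sum]
    refine Finset.sum_congr rfl fun q _ => ?_
    by_cases hq : (q : ℕ) < d
    · rw [hac q hq]; ring
    · rw [hu q (not_lt.mp hq)]; ring
  refine ⟨(LinearMap.ker g).map (firstCoordsSubspace K n d).subtype, ?_, ?_, ?_⟩
  · rintro _ ⟨u, -, rfl⟩
    exact u.2
  · have hsurj : Function.Surjective g := by
      refine LinearMap.surjective fun hzero => hφs ?_
      have hmem : (Pi.single s 1 : Fin n → K) ∈ firstCoordsSubspace K n d := by
        intro i hi
        have : i ≠ s := by rintro rfl; omega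
        simp [this]
      have := LinearMap.congr_fun hzero ⟨_, hmem⟩
      simpa [hg, hev'] using this
    have hrank := LinearMap.finrank_range_add_finrank_ker g
    rw [LinearMap.range_eq_top.mpr hsurj, finrank_top, Module.finrank_self,
      finrank_firstCoordsSubspace K h] at hrank
    rw [Submodule.finrank_map_subtype_eq]
    omega
  · rintro _ ⟨u, hu, rfl⟩
    have hu0 : φ ⬝ᵥ (u : Fin n → K) = 0 := hu
    have hmem : M.mulVec (u : Fin n → K) ∈ firstCoordsSubspace K n d := by
      intro p hp
      show M p ⬝ᵥ (u : Fin n → K) = 0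
      rw [hdot (M p) u u.2 (v p) (fun q hq => hγ p q hp hq), hu0, mul_zero]
    refine ⟨⟨_, hmem⟩, ?_, rfl⟩
    show φ ⬝ᵥ M.mulVec (u : Fin n → K) = 0
    rw [dotProduct_mulVec, hdot (φ ᵥ* M) u u.2 lam, hu0, mul_zero]
    exact hα

/-- The indices of the first `d` coordinates. -/
def lowIdx (n d : ℕ) : Finset (Fin n) := Finset.univ.filter fun r => (r : ℕ) < d

@[simp]
theorem mem_lowIdx {n d : ℕ} {r : Fin n} : r ∈ lowIdx n d ↔ (r : ℕ) < d := by
  simp [lowIdx]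

/-- The `2 × 2` minor of the lower-left block with rows `p, q` and columns `k, l`. -/
noncomputable def quadGen (K : Type*) [Field K] {n : ℕ} (p q k l : Fin n) : MatCoordRing K n :=
  MvPolynomial.X (p, k) * MvPolynomial.X (q, l) - MvPolynomial.X (p, l) * MvPolynomial.X (q, k)

/-- The `2 × 2` minor, in columns `k, l`, of row `p` of the block `γ` and row `q` of `γ * α`. -/
noncomputable def cubGen (K : Type*) [Field K] {n : ℕ} (d : ℕ) (p q k l : Fin n) :
    MatCoordRing K n :=
  ∑ r ∈ lowIdx n d,
    (MvPolynomial.X (p, k) * (MvPolynomial.X (q, r) * MvPolynomial.X (r, l)) -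
      MvPolynomial.X (p, l) * (MvPolynomial.X (q, r) * MvPolynomial.X (r, k)))

/-- The ideal of `2 × 2` minors of the lower-left block. -/
noncomputable def quadIdeal (K : Type*) [Field K] (n d : ℕ) : Ideal (MatCoordRing K n) :=
  Ideal.span {f | ∃ p q k l : Fin n, d ≤ (p : ℕ) ∧ d ≤ (q : ℕ) ∧ (k : ℕ) < d ∧ (l : ℕ) < d ∧
    f = quadGen K p q k l}

/-- The ideal of the cubic minors `cubGen`. -/
noncomputable def cubIdeal (K : Type*) [Field K] (n d : ℕ) : Ideal (MatCoordRing K n) :=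
  Ideal.span {f | ∃ p q k l : Fin n, d ≤ (p : ℕ) ∧ d ≤ (q : ℕ) ∧ (k : ℕ) < d ∧ (l : ℕ) < d ∧
    f = cubGen K d p q k l}

theorem eval_quadGen {K : Type*} [Field K] {n : ℕ} (x : Fin n × Fin n → K) (p q k l : Fin n) :
    MvPolynomial.eval x (quadGen K p q k l) = x (p, k) * x (q, l) - x (p, l) * x (q, k) := by
  simp [quadGen]

theorem eval_cubGen {K : Type*} [Field K] {n d : ℕ} (x : Fin n × Fin n → K) (p q k l : Fin n) :
    MvPolynomial.eval x (cubGen K d p q k l) =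
      x (p, k) * (∑ r ∈ lowIdx n d, x (q, r) * x (r, l)) -
        x (p, l) * (∑ r ∈ lowIdx n d, x (q, r) * x (r, k)) := by
  simp [cubGen, Finset.mul_sum]

theorem quadIdeal_sup_cubIdeal_le {K : Type*} [Field K] {n d : ℕ} (hd : 2 ≤ d) (h : d ≤ n) :
    quadIdeal K n d ⊔ cubIdeal K n d ≤ kalmanIdeal K n d (d - 1) := by
  have hrow : ∀ {U : Submodule K (Fin n → K)} {M : Matrix (Fin n) (Fin n) K},
      U ≤ firstCoordsSubspace K n d → (∀ v ∈ U, M.mulVec v ∈ U) → ∀ p : Fin n, d ≤ (p : ℕ) →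
      ∀ u ∈ U, M p ⬝ᵥ u = 0 := fun hU hM p hp u hu => hU (hM u hu) p hp
  refine sup_le (Ideal.span_le.mpr ?_) (Ideal.span_le.mpr ?_)
  · rintro _ ⟨p, q, k, l, hp, hq, hk, hl, rfl⟩ M ⟨U, hU, hfin, hM⟩
    rw [eval_quadGen, sub_eq_zero]
    exact minor_eq_of_vanish_on_hyperplane hd h hU hfin (hrow hU hM p hp) (hrow hU hM q hq) hk hl
  · rintro _ ⟨p, q, k, l, hp, hq, hk, hl, rfl⟩ M ⟨U, hU, hfin, hM⟩
    rw [eval_cubGen, sub_eq_zero]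
    refine minor_eq_of_vanish_on_hyperplane hd h hU hfin (a := M p)
      (b := fun j => ∑ r ∈ lowIdx n d, M q r * M r j) (hrow hU hM p hp) ?_ hk hl
    intro u hu
    have hMu := hrow hU hM q hq _ (hM u hu)
    have hL := hU (hM u hu)
    rw [← hMu]
    simp only [dotProduct, Finset.sum_mul]
    rw [Finset.sum_comm, lowIdx, Finset.sum_filter]
    refine Finset.sum_congr rfl fun r _ => ?_
    split_ifs with hr
    · simp only [Matrix.mulVec, dotProduct, Finset.mul_sum, mul_assoc]
    · rw [hL r (not_lt.mp hr), mul_zero]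

/-- A parametrized point of the Kalman variety: the lower-left block is `v ψ` and `ψ` is a left
eigenvector of the upper-left block with eigenvalue `lam`, where `ψ` is `φ` normalized to have
`s`-th entry `1`. -/
def kalmanPoint {R : Type*} [CommRing R] {n : ℕ} (d : ℕ) (s : Fin n) (z : Fin n × Fin n → R)
    (v φ : Fin n → R) (lam : R) (x : Fin n × Fin n) : R :=
  if (x.2 : ℕ) < d then
    if (x.1 : ℕ) < d then
      if x.1 = s then lam * Function.update φ s 1 x.2 -
        ∑ r ∈ (lowIdx n d).erase s, Function.update φ s 1 r * z (r, x.2)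
      else z x
    else v x.1 * Function.update φ s 1 x.2
  else z x

theorem map_kalmanPoint {R S : Type*} [CommRing R] [CommRing S] (g : R →+* S) {n : ℕ} (d : ℕ)
    (s : Fin n) (z : Fin n × Fin n → R) (v φ : Fin n → R) (lam : R) (x : Fin n × Fin n) :
    g (kalmanPoint d s z v φ lam x) =
      kalmanPoint d s (fun y => g (z y)) (fun i => g (v i)) (fun i => g (φ i)) (g lam) x := by
  have hupd : ∀ i, g (Function.update φ s 1 i) = Function.update (fun i => g (φ i)) s 1 i := by
    intro i
    by_cases hi : i = s
    · subst hi; simp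
    · simp [hi]
  simp only [kalmanPoint, apply_ite g, map_sub, map_mul, map_sum, hupd]

theorem kalmanPoint_mem {K : Type*} [Field K] {n d : ℕ} (h : d ≤ n) {s : Fin n}
    (hs : (s : ℕ) < d) (z : Fin n × Fin n → K) (v φ : Fin n → K) (lam : K) :
    (fun p q => kalmanPoint d s z v φ lam (p, q) : Matrix (Fin n) (Fin n) K) ∈
      kalmanSet K n d (d - 1) := by
  refine mem_kalmanSet_of_eigenvector h (v := v) (lam := lam) (s := s)
    (φ := fun r => if (r : ℕ) < d then Function.update φ s 1 r else 0) hs (by simp [hs]) ?_ ?_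
  · intro p q hp hq
    simp [kalmanPoint, hq, not_lt.mpr hp]
  · intro q hq
    have hsum : ∀ F : Fin n → K, ∑ r : Fin n, (if (r : ℕ) < d then Function.update φ s 1 r else 0) * F r =
        ∑ r ∈ lowIdx n d, Function.update φ s 1 r * F r := by
      intro F
      rw [lowIdx, Finset.sum_filter]
      exact Finset.sum_congr rfl fun r _ => by split_ifs <;> simp
    rw [hsum, ← Finset.add_sum_erase _ _ (mem_lowIdx.mpr hs)]
    have : ∀ r ∈ (lowIdx n d).erase s, Function.update φ s 1 r * kalmanPoint d s z v φ lam (r, q) =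
        Function.update φ s 1 r * z (r, q) := by
      intro r hr
      obtain ⟨hrs, hrd⟩ := Finset.mem_erase.mp hr
      simp [kalmanPoint, hq, mem_lowIdx.mp hrd, hrs]
    rw [Finset.sum_congr rfl this]
    simp [kalmanPoint, hq, hs]

/-- Elements of the vanishing ideal vanish at points over arbitrary field extensions. -/
theorem aeval_eq_zero_of_mem_kalmanIdeal {K : Type*} [Field K] [Infinite K] {n d : ℕ} (h : d ≤ n)
    {f : MatCoordRing K n} (hf : f ∈ kalmanIdeal K n d (d - 1)) {L : Type*} [Field L] [Algebra K L]
    {x : Fin n × Fin n → L} {v φ : Fin n → L} {lam : L} {s : Fin n} (hs : (s : ℕ) < d)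
    (hφs : φ s ≠ 0)
    (hγ : ∀ p q : Fin n, d ≤ (p : ℕ) → (q : ℕ) < d → x (p, q) = v p * φ q)
    (hα : ∀ q : Fin n, (q : ℕ) < d → ∑ r ∈ lowIdx n d, φ r * x (r, q) = lam * φ q) :
    MvPolynomial.aeval x f = 0 := by
  let X' : (Fin n × Fin n) ⊕ (Fin n ⊕ Option (Fin n)) →
    MvPolynomial ((Fin n × Fin n) ⊕ (Fin n ⊕ Option (Fin n))) K := MvPolynomial.X
  let P := kalmanPoint d s (fun y => X' (.inl y)) (fun i => X' (.inr (.inl i)))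
    (fun i => X' (.inr (.inr (some i)))) (X' (.inr (.inr none)))
  have hgen : MvPolynomial.aeval P f = 0 := by
    refine MvPolynomial.funext fun y => ?_
    rw [map_zero]
    have hcomp : MvPolynomial.eval y (MvPolynomial.aeval P f) =
        MvPolynomial.eval (fun p => MvPolynomial.eval y (P p)) f := by
      simpa [MvPolynomial.aeval_eq_eval] using
        MvPolynomial.comp_aeval_apply (σ := Fin n × Fin n) P (MvPolynomial.aeval y : _ →ₐ[K] K) f
    rw [hcomp]
    have := hf _ (kalmanPoint_mem h hs (fun p => y (.inl p)) (fun i => y (.inr (.inl i)))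
      (fun i => y (.inr (.inr (some i)))) (y (.inr (.inr none))))
    convert this using 3 with p
    funext p
    simp only [P, map_kalmanPoint]
    simp [X']
  let y : (Fin n × Fin n) ⊕ (Fin n ⊕ Option (Fin n)) → L :=
    Sum.elim x (Sum.elim (fun i => v i * φ s) (fun o => o.elim lam fun i => φ i / φ s))
  have hx : x = fun p => MvPolynomial.aeval y (P p) := by
    funext ⟨p, q⟩
    show _ = (MvPolynomial.aeval y : _ →ₐ[K] L).toRingHom (P (p, q))
    rw [map_kalmanPoint]
    have hupd : Function.update (fun i => φ i / φ s) s 1 = fun i => φ i / φ s := by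
      funext i
      by_cases hi : i = s
      · subst hi; simp [hφs]
      · simp [hi]
    simp only [X', AlgHom.toRingHom_eq_coe, RingHom.coe_coe, MvPolynomial.aeval_X, y, Sum.elim_inl,
      Sum.elim_inr, Option.elim_some, Option.elim_none, kalmanPoint, hupd]
    split_ifs with hq hp hps
    · subst hps
      have := hα q hq
      rw [← Finset.add_sum_erase _ _ (mem_lowIdx.mpr hs)] at this
      simp only [div_mul_eq_mul_div, ← Finset.sum_div]
      field_simp
      linear_combination this
    · rfl
    · rw [hγ p q (not_lt.mp hp) hq]
      field_simp
    · rfl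
  rw [hx, ← MvPolynomial.comp_aeval_apply, hgen, map_zero]

/-- The weight on the variables that is `q + 1` on the `q`-th diagonal entry of the upper-left
block and zero elsewhere. -/
def diagWeight (n d : ℕ) (x : Fin n × Fin n) : ℕ :=
  if x.1 = x.2 ∧ (x.2 : ℕ) < d then (x.2 : ℕ) + 1 else 0

theorem exists_powerSeries_fixedPoint {K ι : Type*} [Field K] [Fintype ι] [DecidableEq ι]
    (T : Matrix ι ι (PowerSeries K)) (u : ι → PowerSeries K) :
    ∃ φ : ι → PowerSeries K, φ = u + (PowerSeries.X : PowerSeries K) • (T *ᵥ φ) := by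
  have hdet : IsUnit (1 - (PowerSeries.X : PowerSeries K) • T).det := by
    rw [PowerSeries.isUnit_iff_constantCoeff, RingHom.map_det]
    have : (PowerSeries.constantCoeff (R := K)).mapMatrix
        (1 - (PowerSeries.X : PowerSeries K) • T) = 1 := by
      ext i j
      by_cases hij : i = j <;> simp [hij, Matrix.one_apply]
    rw [this, Matrix.det_one]
    exact isUnit_one
  refine ⟨(1 - (PowerSeries.X : PowerSeries K) • T)⁻¹ *ᵥ u, ?_⟩
  have h := Matrix.mulVec_mulVec u (1 - (PowerSeries.X : PowerSeries K) • T)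
    (1 - (PowerSeries.X : PowerSeries K) • T)⁻¹
  rw [Matrix.mul_nonsing_inv _ hdet, Matrix.one_mulVec, Matrix.sub_mulVec, Matrix.one_mulVec,
    Matrix.smul_mulVec] at h
  exact sub_eq_iff_eq_add.mp h

/-- If `f` has weight at most `W` and vanishes at a point of the fraction field of the power series
ring whose coordinates have poles of order at most their weight, then the top weight component of
`f` vanishes at the vector of leading coefficients. -/
theorem eval_weightedHomogeneousComponent_eq_zero {K σ : Type*} [Field K] {w : σ → ℕ} {W : ℕ}
    {f : MvPolynomial σ K} (hW : ∀ m ∈ f.support, Finsupp.weight w m ≤ W)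
    {b : σ → PowerSeries K} {x : σ → FractionRing (PowerSeries K)}
    (hx : ∀ i, algebraMap (PowerSeries K) (FractionRing (PowerSeries K)) (b i) =
      algebraMap (PowerSeries K) (FractionRing (PowerSeries K)) PowerSeries.X ^ w i * x i)
    (hf : MvPolynomial.aeval x f = 0) :
    MvPolynomial.eval (fun i => PowerSeries.constantCoeff (b i))
      (MvPolynomial.weightedHomogeneousComponent w W f) = 0 := by
  set F : PowerSeries K := ∑ m ∈ f.support, PowerSeries.C (f.coeff m) *
    (PowerSeries.X ^ (W - Finsupp.weight w m) * m.prod fun i e => b i ^ e) with hF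
  have hF0 : F = 0 := by
    apply IsFractionRing.injective (PowerSeries K) (FractionRing (PowerSeries K))
    rw [map_zero, hF, map_sum, ← mul_zero
      (algebraMap (PowerSeries K) (FractionRing (PowerSeries K)) PowerSeries.X ^ W), ← hf, MvPolynomial.aeval_def,
      MvPolynomial.eval₂_eq, Finset.mul_sum]
    refine Finset.sum_congr rfl fun m hm => ?_
    have hprod : algebraMap (PowerSeries K) (FractionRing (PowerSeries K))
        (m.prod fun i e => b i ^ e) =
        algebraMap (PowerSeries K) (FractionRing (PowerSeries K)) PowerSeries.X ^
          Finsupp.weight w m * ∏ i ∈ m.support, x i ^ m i := by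
      rw [Finsupp.prod, map_prod, Finsupp.weight_apply, Finsupp.sum, ← Finset.prod_pow_eq_pow_sum,
        ← Finset.prod_mul_distrib]
      refine Finset.prod_congr rfl fun i _ => ?_
      rw [map_pow, hx, mul_pow, ← pow_mul, smul_eq_mul, mul_comm (w i)]
    have hC : algebraMap (PowerSeries K) (FractionRing (PowerSeries K))
        (PowerSeries.C (f.coeff m)) = algebraMap K (FractionRing (PowerSeries K)) (f.coeff m) := by
      rw [IsScalarTower.algebraMap_apply K (PowerSeries K) (FractionRing (PowerSeries K)),
        PowerSeries.algebraMap_apply, Algebra.algebraMap_self_apply]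
    rw [map_mul, map_mul, hprod, hC, map_pow, ← mul_assoc (_ ^ (W - _)), ← pow_add,
      Nat.sub_add_cancel (hW m hm)]
    ring
  have h0 := congrArg (PowerSeries.constantCoeff (R := K)) hF0
  rw [map_zero, hF, map_sum] at h0
  rw [MvPolynomial.weightedHomogeneousComponent_apply, map_sum, Finset.sum_filter]
  refine (Finset.sum_congr rfl fun m hm => ?_).trans h0
  rw [MvPolynomial.eval_monomial]
  split_ifs with hw
  · simp [hw, Finsupp.prod]
  · have : W - Finsupp.weight w m ≠ 0 := by
      have := hW m hm
      omega
    simp [this]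

theorem eval_top_eq_zero_of_mem_kalmanIdeal {K : Type*} [Field K] [Infinite K] {n d : ℕ}
    (h : d ≤ n) {f : MatCoordRing K n} (hf : f ∈ kalmanIdeal K n d (d - 1)) {W : ℕ}
    (hW : ∀ m ∈ f.support, Finsupp.weight (diagWeight n d) m ≤ W) {S : Finset (Fin n)}
    (hS : ∀ j ∈ S, (j : ℕ) < d) {s : Fin n} (hsS : s ∈ S) (hmin : ∀ j ∈ S, s ≤ j)
    {z : Fin n × Fin n → K} (hz : ∀ j, z (j, j) ≠ 0) (v : Fin n → K) {φ₀ : Fin n → K}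
    (hφ₀ : ∀ j, φ₀ j ≠ 0) :
    MvPolynomial.eval (fun x : Fin n × Fin n => if (x.2 : ℕ) < d then
        if (x.1 : ℕ) < d then if x.1 = x.2 ∧ x.2 ∈ S ∧ x.2 ≠ s then 0 else z x
        else v x.1 * (if x.2 ∈ S then φ₀ x.2 else 0)
      else z x)
      (MvPolynomial.weightedHomogeneousComponent (diagWeight n d) W f) = 0 := by
  classical
  have hs := hS s hsS
  let A := algebraMap (PowerSeries K) (FractionRing (PowerSeries K))
  have hτ : A PowerSeries.X ≠ 0 := by
    intro h0
    exact PowerSeries.X_ne_zero (IsFractionRing.injective (PowerSeries K)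
      (FractionRing (PowerSeries K)) (h0.trans (map_zero A).symm))
  let c : K → PowerSeries K := fun a => PowerSeries.C a
  have hc : ∀ a, a ≠ 0 → A (c a) ≠ 0 := by
    intro a ha h0
    have := IsFractionRing.injective (PowerSeries K)
      (FractionRing (PowerSeries K)) (h0.trans (map_zero A).symm)
    apply ha
    have := congrArg (PowerSeries.constantCoeff (R := K)) this
    simpa [c] using this
  let M : Fin n → ℕ := fun j => max (j : ℕ) s
  let D : Fin n → PowerSeries K := fun j =>
    PowerSeries.X ^ (M j - s) * c (z (s, s)) - PowerSeries.X ^ (M j - j) * c (z (j, j))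
  have hD : ∀ j, j ∉ S → ∃ E, D j * E = 1 := by
    intro j hj
    refine IsUnit.exists_right_inv (PowerSeries.isUnit_iff_constantCoeff.mpr (isUnit_iff_ne_zero.mpr ?_))
    have hjs : j ≠ s := by rintro rfl; exact hj hsS
    have hjs' : (j : ℕ) ≠ s := fun h => hjs (Fin.ext h)
    rcases lt_or_gt_of_ne hjs' with hlt | hlt
    · have h1 : M j - s = 0 := by simp [M]; omega
      have h2 : M j - j ≠ 0 := by simp [M]; omega
      simp [D, c, h1, h2, hz]
    · have h1 : M j - s ≠ 0 := by simp [M]; omega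
      have h2 : M j - j = 0 := by simp [M]; omega
      simp [D, c, h1, h2, hz]
  choose! E hE using hD
  obtain ⟨φ, hφ⟩ := exists_powerSeries_fixedPoint
    (fun j i => if j ∉ S ∧ i ∈ (lowIdx n d).erase j then
      PowerSeries.X ^ M j * E j * c (z (i, j)) else 0 : Matrix (Fin n) (Fin n) (PowerSeries K))
    (fun j => if j ∈ S then c (φ₀ j) else 0)
  have hφS : ∀ j ∈ S, φ j = c (φ₀ j) := by
    intro j hj
    rw [hφ]
    simp [hj, Matrix.mulVec, dotProduct]
  have hφ0 : ∀ j, PowerSeries.constantCoeff (φ j) = if j ∈ S then φ₀ j else 0 := by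
    intro j
    rw [hφ]
    simp [apply_ite (PowerSeries.constantCoeff (R := K)), c]
  have hφD : ∀ j, j ∉ S → D j * φ j =
      PowerSeries.X ^ (M j + 1) * ∑ i ∈ (lowIdx n d).erase j, φ i * c (z (i, j)) := by
    intro j hj
    have : φ j = PowerSeries.X * ∑ i ∈ (lowIdx n d).erase j,
        PowerSeries.X ^ M j * E j * c (z (i, j)) * φ i := by
      conv_lhs => rw [hφ]
      simp only [hj, Pi.add_apply, Pi.smul_apply, if_false, zero_add, smul_eq_mul, Matrix.mulVec,
        dotProduct, not_false_eq_true, true_and, ite_mul, zero_mul, Finset.sum_ite_mem,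
        Finset.univ_inter]
    rw [this, Finset.mul_sum, Finset.mul_sum, Finset.mul_sum]
    refine Finset.sum_congr rfl fun i _ => ?_
    linear_combination (PowerSeries.X ^ (M j + 1) * c (z (i, j)) * φ i) * hE j hj
  let u : Fin n → PowerSeries K := fun j => ∑ i ∈ (lowIdx n d).erase j, φ i * c (z (i, j))
  let lam := A (c (z (s, s))) / A PowerSeries.X ^ ((s : ℕ) + 1)
  let x : Fin n × Fin n → FractionRing (PowerSeries K) := fun y =>
    if (y.2 : ℕ) < d then
      if (y.1 : ℕ) < d then
        if y.1 = y.2 then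
          if y.2 ∈ S then lam - A (u y.2) / A (c (φ₀ y.2))
          else A (c (z y)) / A PowerSeries.X ^ ((y.2 : ℕ) + 1)
        else A (c (z y))
      else A (c (v y.1)) * A (φ y.2)
    else A (c (z y))
  let b : Fin n × Fin n → PowerSeries K := fun y =>
    if (y.2 : ℕ) < d then
      if (y.1 : ℕ) < d then
        if y.1 = y.2 then
          if y.2 ∈ S then PowerSeries.X ^ ((y.2 : ℕ) - s) * c (z (s, s)) -
            PowerSeries.X ^ ((y.2 : ℕ) + 1) * (u y.2 * c (φ₀ y.2)⁻¹)
          else c (z y)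
        else c (z y)
      else c (v y.1) * φ y.2
    else c (z y)
  have hx0 : MvPolynomial.aeval x f = 0 := by
    refine aeval_eq_zero_of_mem_kalmanIdeal h hf (v := fun p => A (c (v p))) (φ := fun j => A (φ j))
      (lam := lam) hs ?_ ?_ ?_
    · rw [hφS s hsS]; exact hc _ (hφ₀ s)
    · intro p q hp hq
      simp [x, hq, not_lt.mpr hp]
    · intro q hq
      rw [← Finset.add_sum_erase _ _ (mem_lowIdx.mpr hq)]
      have hu : ∑ r ∈ (lowIdx n d).erase q, A (φ r) * x (r, q) = A (u q) := by
        rw [map_sum]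
        refine Finset.sum_congr rfl fun r hr => ?_
        obtain ⟨hrq, hrd⟩ := Finset.mem_erase.mp hr
        simp [x, hq, mem_lowIdx.mp hrd, hrq]
      rw [hu]
      by_cases hqS : q ∈ S
      · have := hc _ (hφ₀ q)
        simp only [x, hq, hqS, if_true, hφS q hqS]
        field_simp
        ring
      · have hDq := congrArg A (hφD q hqS)
        simp only [x, hq, hqS, if_true, if_false, lam]
        simp only [D, map_mul, map_sub, map_pow] at hDq
        have h1 : M q + 1 = (M q - s) + (s + 1) := by simp only [M]; omega
        have h2 : M q + 1 = (M q - q) + (q + 1) := by simp only [M]; omega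
        have h3 : A PowerSeries.X ^ (M q + 1) * (A (c (z (s, s))) / A PowerSeries.X ^ ((s : ℕ) + 1)) =
            A PowerSeries.X ^ (M q - s) * A (c (z (s, s))) := by
          rw [h1, pow_add]
          field_simp
        have h4 : A PowerSeries.X ^ (M q + 1) * (A (c (z (q, q))) / A PowerSeries.X ^ ((q : ℕ) + 1)) =
            A PowerSeries.X ^ (M q - q) * A (c (z (q, q))) := by
          rw [h2, pow_add]
          field_simp
        apply mul_left_cancel₀ (pow_ne_zero (M q + 1) hτ)
        linear_combination A (φ q) * h4 - A (φ q) * h3 - hDq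
  have hb : ∀ y, A (b y) = A PowerSeries.X ^ diagWeight n d y * x y := by
    rintro ⟨p, q⟩
    by_cases hq : (q : ℕ) < d
    · by_cases hp : (p : ℕ) < d
      · by_cases hpq : p = q
        · subst hpq
          by_cases hpS : p ∈ S
          · have h1 : (p : ℕ) + 1 = (p - s) + (s + 1) := by
              have : (s : ℕ) ≤ p := hmin p hpS
              omega
            have hinv : A (c (φ₀ p)⁻¹) = (A (c (φ₀ p)))⁻¹ := by
              refine eq_inv_of_mul_eq_one_left ?_
              rw [← map_mul, ← map_mul, inv_mul_cancel₀ (hφ₀ p), map_one, map_one]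
            simp only [b, x, diagWeight, hq, hpS, if_true, and_self, lam, map_sub, map_mul, map_pow,
              hinv, mul_sub]
            congr 1
            rw [h1, pow_add]
            field_simp
          · simp [b, x, diagWeight, hq, hpS]
            field_simp
        · simp [b, x, diagWeight, hq, hp, hpq]
      · have hpq : p ≠ q := by rintro rfl; exact hp hq
        simp [b, x, diagWeight, hq, hp, hpq]
    · simp [b, x, diagWeight, hq]
  have := eval_weightedHomogeneousComponent_eq_zero hW hb hx0
  convert this using 3
  funext y
  obtain ⟨p, q⟩ := y
  by_cases hq : (q : ℕ) < d
  · by_cases hp : (p : ℕ) < d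
    · by_cases hpq : p = q
      · subst hpq
        by_cases hpS : p ∈ S
        · by_cases hps : p = s
          · subst hps
            simp [b, hq, hpS, c]
          · have hsub : (p : ℕ) - s ≠ 0 := by
              have : s < p := lt_of_le_of_ne (hmin p hpS) (Ne.symm hps)
              have : (s : ℕ) < p := this
              omega
            simp [b, hq, hpS, hps, c, hsub]
        · simp [b, hq, hpS, c]
      · simp [b, hq, hp, hpq, c]
    · simp [b, hq, hp, c, hφ0]
  · simp [b, hq, c]

/-- The exponent vector of the image of a variable under `γ_{pq} ↦ v_p φ_q`. -/
noncomputable def rankOneExp {n : ℕ} (d : ℕ) (x : Fin n × Fin n) :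
    ((Fin n × Fin n) ⊕ (Fin n ⊕ Fin n)) →₀ ℕ :=
  if d ≤ (x.1 : ℕ) ∧ (x.2 : ℕ) < d then
    Finsupp.single (.inr (.inl x.1)) 1 + Finsupp.single (.inr (.inr x.2)) 1
  else Finsupp.single (.inl x) 1

/-- The exponent vector of the image of a monomial under `γ_{pq} ↦ v_p φ_q`. -/
noncomputable def content {n : ℕ} (d : ℕ) :
    ((Fin n × Fin n) →₀ ℕ) →ₗ[ℕ] (((Fin n × Fin n) ⊕ (Fin n ⊕ Fin n)) →₀ ℕ) :=
  Finsupp.linearCombination ℕ (rankOneExp d)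

theorem content_single_one {n d : ℕ} (x : Fin n × Fin n) :
    content d (Finsupp.single x 1) = rankOneExp d x := by
  simp [content]

theorem Finsupp.exists_eq_single_add {σ : Type*} {m : σ →₀ ℕ} {x : σ} (hx : m x ≠ 0) :
    ∃ m₁, m = Finsupp.single x 1 + m₁ :=
  ⟨m - Finsupp.single x 1, (add_tsub_cancel_of_le
    (Finsupp.single_le_iff.mpr (Nat.one_le_iff_ne_zero.mpr hx))).symm⟩

theorem content_apply_ne_zero_iff {n d : ℕ} {m : (Fin n × Fin n) →₀ ℕ}
    {t : (Fin n × Fin n) ⊕ (Fin n ⊕ Fin n)} :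
    content d m t ≠ 0 ↔ ∃ x, m x ≠ 0 ∧ rankOneExp d x t ≠ 0 := by
  constructor
  · intro h
    rw [content, Finsupp.linearCombination_apply, Finsupp.sum, Finsupp.finsetSum_apply] at h
    obtain ⟨x, hx, hne⟩ := Finset.exists_ne_zero_of_sum_ne_zero h
    refine ⟨x, Finsupp.mem_support_iff.mp hx, fun h0 => hne ?_⟩
    simp [h0]
  · rintro ⟨x, hx, ht⟩
    obtain ⟨m₁, rfl⟩ := Finsupp.exists_eq_single_add hx
    rw [map_add, content_single_one, Finsupp.add_apply]
    omega

theorem rankOneExp_inl_ne_zero_iff {n d : ℕ} {x y : Fin n × Fin n} :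
    rankOneExp d x (.inl y) ≠ 0 ↔ x = y ∧ ¬ (d ≤ (y.1 : ℕ) ∧ (y.2 : ℕ) < d) := by
  unfold rankOneExp
  by_cases hxy : x = y
  · subst hxy
    split_ifs with h <;> simp [h]
  · split_ifs with h <;> simp [hxy]

theorem rankOneExp_inr_inl_ne_zero_iff {n d : ℕ} {x : Fin n × Fin n} {p : Fin n} :
    rankOneExp d x (.inr (.inl p)) ≠ 0 ↔ x.1 = p ∧ d ≤ (p : ℕ) ∧ (x.2 : ℕ) < d := by
  unfold rankOneExp
  by_cases hxy : x.1 = p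
  · subst hxy
    split_ifs with h <;> simp [h]
  · split_ifs with h <;> simp [hxy]

theorem rankOneExp_inr_inr_ne_zero_iff {n d : ℕ} {x : Fin n × Fin n} {q : Fin n} :
    rankOneExp d x (.inr (.inr q)) ≠ 0 ↔ x.2 = q ∧ d ≤ (x.1 : ℕ) ∧ (q : ℕ) < d := by
  unfold rankOneExp
  by_cases hxy : x.2 = q
  · subst hxy
    split_ifs with h <;> simp [h]
  · split_ifs with h <;> simp [hxy]

theorem quadGen_mem_quadIdeal (K : Type*) [Field K] {n d : ℕ} {p q k l : Fin n} (hp : d ≤ (p : ℕ))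
    (hq : d ≤ (q : ℕ)) (hk : (k : ℕ) < d) (hl : (l : ℕ) < d) :
    quadGen K p q k l ∈ quadIdeal K n d :=
  Ideal.subset_span ⟨p, q, k, l, hp, hq, hk, hl, rfl⟩

theorem cubGen_mem_cubIdeal (K : Type*) [Field K] {n d : ℕ} {p q k l : Fin n} (hp : d ≤ (p : ℕ))
    (hq : d ≤ (q : ℕ)) (hk : (k : ℕ) < d) (hl : (l : ℕ) < d) :
    cubGen K d p q k l ∈ cubIdeal K n d :=
  Ideal.subset_span ⟨p, q, k, l, hp, hq, hk, hl, rfl⟩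

theorem monomial_single_add {K σ : Type*} [CommSemiring K] (x : σ) (m : σ →₀ ℕ) :
    MvPolynomial.monomial (Finsupp.single x 1 + m) (1 : K) =
      MvPolynomial.X x * MvPolynomial.monomial m 1 := by
  simp [MvPolynomial.X, MvPolynomial.monomial_mul]

/-- A variable occurring in a monomial divides, modulo the quadrics, every monomial with the same
content. -/
theorem exists_single_add_of_content_eq (K : Type*) [Field K] {n d : ℕ}
    {m m' : (Fin n × Fin n) →₀ ℕ} (h : content d m = content d m') {x : Fin n × Fin n}
    (hx : m x ≠ 0) :
    ∃ m₁, content d (Finsupp.single x 1 + m₁) = content d m' ∧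
      MvPolynomial.monomial (Finsupp.single x 1 + m₁) (1 : K) - MvPolynomial.monomial m' 1 ∈
        quadIdeal K n d := by
  by_cases hm'x : m' x ≠ 0
  · obtain ⟨m₁, rfl⟩ := Finsupp.exists_eq_single_add hm'x
    exact ⟨m₁, rfl, by simp⟩
  by_cases hγ : d ≤ (x.1 : ℕ) ∧ (x.2 : ℕ) < d
  · obtain ⟨p, j⟩ := x
    have h1 : content d m' (.inr (.inl p)) ≠ 0 := by
      rw [← h, content_apply_ne_zero_iff]
      exact ⟨_, hx, rankOneExp_inr_inl_ne_zero_iff.mpr ⟨rfl, hγ⟩⟩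
    have h2 : content d m' (.inr (.inr j)) ≠ 0 := by
      rw [← h, content_apply_ne_zero_iff]
      exact ⟨_, hx, rankOneExp_inr_inr_ne_zero_iff.mpr ⟨rfl, hγ⟩⟩
    obtain ⟨⟨p', k⟩, hy, hy'⟩ := content_apply_ne_zero_iff.mp h1
    obtain ⟨⟨q, j'⟩, hw, hw'⟩ := content_apply_ne_zero_iff.mp h2
    obtain ⟨rfl, hp, hk⟩ := rankOneExp_inr_inl_ne_zero_iff.mp hy'
    obtain ⟨rfl, hq, hj⟩ := rankOneExp_inr_inr_ne_zero_iff.mp hw'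
    simp only at *
    obtain ⟨m₁, rfl⟩ := Finsupp.exists_eq_single_add hy
    have hne : (p', k) ≠ (q, j') := by
      intro heq
      obtain ⟨rfl, rfl⟩ := Prod.mk.inj heq
      exact hm'x hy
    have hw2 : m₁ (q, j') ≠ 0 := by
      rwa [Finsupp.add_apply, Finsupp.single_eq_of_ne' hne, zero_add] at hw
    obtain ⟨m₂, rfl⟩ := Finsupp.exists_eq_single_add hw2
    refine ⟨Finsupp.single (q, k) 1 + m₂, ?_, ?_⟩
    · simp only [map_add, content_single_one, rankOneExp, hp, hq, hk, hj, and_self, if_true]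
      abel
    · simp only [monomial_single_add]
      have := Ideal.mul_mem_left _ (MvPolynomial.monomial m₂ 1)
        (quadGen_mem_quadIdeal K hp hq hj hk)
      convert this using 1
      rw [quadGen]
      ring
  · have h1 : content d m' (.inl x) ≠ 0 := by
      rw [← h, content_apply_ne_zero_iff]
      exact ⟨_, hx, rankOneExp_inl_ne_zero_iff.mpr ⟨rfl, hγ⟩⟩
    obtain ⟨y, hy, hy'⟩ := content_apply_ne_zero_iff.mp h1
    obtain ⟨rfl, -⟩ := rankOneExp_inl_ne_zero_iff.mp hy'
    exact absurd hy hm'x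

theorem rankOneExp_ne_zero {n d : ℕ} (x : Fin n × Fin n) : rankOneExp d x ≠ 0 := by
  unfold rankOneExp
  split_ifs
  · intro h
    have := DFunLike.congr_fun h (.inr (.inl x.1))
    simp at this
  · simp

/-- Monomials with the same content are congruent modulo the quadrics. -/
theorem monomial_sub_mem_quadIdeal (K : Type*) [Field K] {n d : ℕ}
    {m m' : (Fin n × Fin n) →₀ ℕ} (h : content d m = content d m') :
    MvPolynomial.monomial m (1 : K) - MvPolynomial.monomial m' 1 ∈ quadIdeal K n d := by
  induction hN : m.degree generalizing m m' with
  | zero =>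
    obtain rfl := (Finsupp.degree_eq_zero_iff m).mp hN
    have : m' = 0 := by
      by_contra hne
      obtain ⟨x, hx⟩ := Finsupp.ne_iff.mp hne
      obtain ⟨m₁, rfl⟩ := Finsupp.exists_eq_single_add hx
      rw [map_zero, map_add, content_single_one] at h
      exact rankOneExp_ne_zero x (add_eq_zero.mp h.symm).1
    simp [this]
  | succ N ih =>
    have hne : m ≠ 0 := by
      rintro rfl
      simp at hN
    obtain ⟨x, hx⟩ := Finsupp.ne_iff.mp hne
    obtain ⟨m₁', hm₁', hmem⟩ := exists_single_add_of_content_eq K h hx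
    obtain ⟨m₁, rfl⟩ := Finsupp.exists_eq_single_add hx
    rw [← h, map_add, map_add] at hm₁'
    have hdeg : m₁.degree = N := by
      rw [map_add, Finsupp.degree_single] at hN
      omega
    have := Ideal.mul_mem_left _ (MvPolynomial.X x) (ih (add_left_cancel hm₁').symm hdeg)
    convert Ideal.add_mem _ this hmem using 1
    rw [monomial_single_add, monomial_single_add]
    ring

theorem weight_diagWeight_eq_content {n d : ℕ} (m : (Fin n × Fin n) →₀ ℕ) :
    Finsupp.weight (diagWeight n d) m =
      Finsupp.weight (Sum.elim (diagWeight n d) fun _ => 0) (content d m) := by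
  suffices h : Finsupp.weight (diagWeight n d) =
      (Finsupp.weight (Sum.elim (diagWeight n d) fun _ => 0)).comp (content d).toAddMonoidHom from
    DFunLike.congr_fun h m
  refine Finsupp.addHom_ext' fun x => AddMonoidHom.ext_nat ?_
  simp only [AddMonoidHom.comp_apply, Finsupp.singleAddHom_apply, LinearMap.toAddMonoidHom_coe,
    content_single_one, Finsupp.weight_single, rankOneExp]
  split_ifs with h
  · have : ¬ (x.1 = x.2 ∧ (x.2 : ℕ) < d) := by
      rintro ⟨h1, h2⟩
      rw [h1] at h
      omega
    simp [Finsupp.weight_single, diagWeight, this]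
  · simp [Finsupp.weight_single]

theorem aeval_rankOneExp_monomial {K : Type*} [Field K] {n d : ℕ} (m : (Fin n × Fin n) →₀ ℕ)
    (a : K) :
    MvPolynomial.aeval (fun x => MvPolynomial.monomial (rankOneExp d x) (1 : K))
      (MvPolynomial.monomial m a) = MvPolynomial.monomial (content d m) a := by
  rw [MvPolynomial.aeval_monomial, content, Finsupp.linearCombination_apply, Finsupp.prod,
    Finsupp.sum]
  simp only [MvPolynomial.monomial_pow, one_pow]
  rw [← MvPolynomial.monomial_sum_one, MvPolynomial.algebraMap_eq, MvPolynomial.C_mul_monomial,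
    mul_one]

theorem coeff_aeval_rankOneExp {K : Type*} [Field K] {n d : ℕ} {f : MatCoordRing K n}
    (hinj : Set.InjOn (content d) (f.support : Set ((Fin n × Fin n) →₀ ℕ)))
    {m : (Fin n × Fin n) →₀ ℕ} (hm : m ∈ f.support) :
    (MvPolynomial.aeval (fun x => MvPolynomial.monomial (rankOneExp d x) (1 : K)) f).coeff
      (content d m) = f.coeff m := by
  classical
  conv_lhs => rw [f.as_sum]
  simp only [map_sum, aeval_rankOneExp_monomial, MvPolynomial.coeff_sum, MvPolynomial.coeff_monomial]
  rw [Finset.sum_eq_single m]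
  · simp
  · intro m' hm' hne
    rw [if_neg]
    exact fun h => hne (hinj hm' hm h)
  · exact fun h => absurd hm h

/-- A polynomial vanishing at all points whose zero coordinates are exactly those in `Z` has no
monomial avoiding `Z`. -/
theorem coeff_eq_zero_of_eval_eq_zero {K τ : Type*} [Field K] [Infinite K] [DecidableEq τ]
    (g : MvPolynomial τ K) (Z : τ → Prop) [DecidablePred Z]
    (hg : ∀ t : τ → K, (∀ i, t i ≠ 0) →
      MvPolynomial.eval (fun i => if Z i then 0 else t i) g = 0)
    {κ : τ →₀ ℕ} (hκ : ∀ i, Z i → κ i = 0) : g.coeff κ = 0 := by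
  have hcoeff : ∀ g : MvPolynomial τ K,
      (MvPolynomial.aeval (fun i => if Z i then (0 : MvPolynomial τ K) else MvPolynomial.X i)
        g).coeff κ = g.coeff κ := by
    intro g
    induction g using MvPolynomial.induction_on' with
    | monomial m a =>
      rw [MvPolynomial.aeval_monomial, Finsupp.prod]
      by_cases hm : ∃ i ∈ m.support, Z i
      · obtain ⟨i, him, hi⟩ := hm
        rw [Finset.prod_eq_zero him (by
          rw [if_pos hi, zero_pow (Finsupp.mem_support_iff.mp him)]), mul_zero,
          MvPolynomial.coeff_zero, MvPolynomial.coeff_monomial, if_neg]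
        rintro rfl
        exact Finsupp.mem_support_iff.mp him (hκ i hi)
      · push Not at hm
        rw [Finset.prod_congr rfl fun i hi => by rw [if_neg (hm i hi)], MvPolynomial.monomial_eq]
        rfl
    | add p q hp hq => rw [map_add, MvPolynomial.coeff_add, MvPolynomial.coeff_add, hp, hq]
  have hzero : MvPolynomial.aeval
      (fun i => if Z i then (0 : MvPolynomial τ K) else MvPolynomial.X i) g = 0 := by
    refine MvPolynomial.funext_set (fun _ => {0}ᶜ) (fun _ => (Set.finite_singleton 0).infinite_compl)
      fun t ht => ?_
    rw [map_zero, ← hg t fun i => ht i trivial]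
    have := MvPolynomial.comp_aeval_apply
      (fun i => if Z i then (0 : MvPolynomial τ K) else MvPolynomial.X i)
      (MvPolynomial.aeval t : _ →ₐ[K] K) g
    rw [MvPolynomial.aeval_eq_eval, MvPolynomial.aeval_eq_eval] at this
    refine this.trans ?_
    congr 2
    funext i
    split_ifs <;> simp
  rw [← hcoeff g, hzero, MvPolynomial.coeff_zero]

/-- Top-weight monomials of elements of the vanishing ideal are divisible by leading monomials of
the cubic generators. -/
theorem exists_lead_of_mem_kalmanIdeal {K : Type*} [Field K] [Infinite K] {n d : ℕ}
    (hd : 0 < d) (h : d ≤ n) {f : MatCoordRing K n} (hf : f ∈ kalmanIdeal K n d (d - 1)) {W : ℕ}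
    (hW : ∀ m ∈ f.support, Finsupp.weight (diagWeight n d) m ≤ W)
    (hinj : Set.InjOn (content d) (f.support : Set ((Fin n × Fin n) →₀ ℕ)))
    {m : (Fin n × Fin n) →₀ ℕ} (hm : m ∈ f.support)
    (hmW : Finsupp.weight (diagWeight n d) m = W) :
    ∃ (p q k l : Fin n) (m₁ : (Fin n × Fin n) →₀ ℕ), d ≤ (p : ℕ) ∧ d ≤ (q : ℕ) ∧ (l : ℕ) < d ∧
      k < l ∧ m = Finsupp.single (p, k) 1 + (Finsupp.single (q, l) 1 +
        (Finsupp.single (l, l) 1 + m₁)) := by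
  classical
  by_contra hcon
  have hlead : ∀ p q k l : Fin n, d ≤ (p : ℕ) → d ≤ (q : ℕ) → (l : ℕ) < d → k < l →
      m (p, k) ≠ 0 → m (q, l) ≠ 0 → m (l, l) = 0 := by
    intro p q k l hp hq hl hkl h1 h2
    by_contra h3
    obtain ⟨m₁, rfl⟩ := Finsupp.exists_eq_single_add h1
    have hne : (p, k) ≠ (q, l) := fun heq => hkl.ne (congrArg Prod.snd heq)
    rw [Finsupp.add_apply, Finsupp.single_eq_of_ne' hne, zero_add] at h2
    obtain ⟨m₂, rfl⟩ := Finsupp.exists_eq_single_add h2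
    have hne1 : (p, k) ≠ (l, l) := fun heq => hkl.ne (congrArg Prod.snd heq)
    have hne2 : (q, l) ≠ (l, l) := fun heq => by
      have := congrArg (Fin.val ∘ Prod.fst) heq
      simp at this
      omega
    rw [Finsupp.add_apply, Finsupp.single_eq_of_ne' hne1, zero_add, Finsupp.add_apply,
      Finsupp.single_eq_of_ne' hne2, zero_add] at h3
    obtain ⟨m₃, rfl⟩ := Finsupp.exists_eq_single_add h3
    exact hcon ⟨p, q, k, l, m₃, hp, hq, hl, hkl, rfl⟩
  obtain ⟨S, hSd, hSne, hSl, hSm⟩ : ∃ S : Finset (Fin n), (∀ j ∈ S, (j : ℕ) < d) ∧ S.Nonempty ∧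
      (∀ l ∈ S, ∀ k ∈ S, k < l → m (l, l) = 0) ∧
      ∀ j : Fin n, j ∉ S → content d m (.inr (.inr j)) = 0 := by
    let S₀ : Finset (Fin n) := {j | content d m (.inr (.inr j)) ≠ 0}
    have hS₀ : ∀ j ∈ S₀, ∃ p : Fin n, m (p, j) ≠ 0 ∧ d ≤ (p : ℕ) ∧ (j : ℕ) < d := by
      intro j hj
      obtain ⟨⟨p, q⟩, h1, h2⟩ := content_apply_ne_zero_iff.mp (Finset.mem_filter.mp hj).2
      obtain ⟨rfl, h3⟩ := rankOneExp_inr_inr_ne_zero_iff.mp h2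
      exact ⟨p, h1, h3⟩
    by_cases hne : S₀.Nonempty
    · refine ⟨S₀, fun j hj => (hS₀ j hj).choose_spec.2.2, hne, fun l hl k hk hkl => ?_, fun j hj => ?_⟩
      · obtain ⟨q, h1, hq, hld⟩ := hS₀ l hl
        obtain ⟨p, h2, hp, -⟩ := hS₀ k hk
        exact hlead p q k l hp hq hld hkl h2 h1
      · by_contra h0
        exact hj (Finset.mem_filter.mpr ⟨Finset.mem_univ _, h0⟩)
    · refine ⟨{⟨0, by omega⟩}, by simpa using hd, by simp, ?_, fun j _ => ?_⟩
      · intro l hl k hk hkl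
        rw [Finset.mem_singleton] at hl hk
        exact absurd (hk.trans hl.symm) hkl.ne
      · by_contra h0
        exact hne ⟨j, Finset.mem_filter.mpr ⟨Finset.mem_univ _, h0⟩⟩
  have hs := S.min'_mem hSne
  set s := S.min' hSne
  set g := MvPolynomial.weightedHomogeneousComponent (diagWeight n d) W f with hg
  have hgcoeff : g.coeff m = f.coeff m := by
    rw [hg, MvPolynomial.coeff_weightedHomogeneousComponent, if_pos hmW]
  have hgsupp : (g.support : Set ((Fin n × Fin n) →₀ ℕ)) ⊆ f.support := by
    intro m' hm'
    have := MvPolynomial.mem_support_iff.mp hm'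
    rw [hg, MvPolynomial.coeff_weightedHomogeneousComponent] at this
    exact MvPolynomial.mem_support_iff.mpr fun h0 => this (by simp [h0])
  have hmg : m ∈ g.support := by
    rw [MvPolynomial.mem_support_iff, hgcoeff]
    exact MvPolynomial.mem_support_iff.mp hm
  refine MvPolynomial.mem_support_iff.mp hmg ?_
  rw [← coeff_aeval_rankOneExp (hinj.mono hgsupp) hmg]
  refine coeff_eq_zero_of_eval_eq_zero _
    (Sum.elim (fun y : Fin n × Fin n => y.1 = y.2 ∧ y.2 ∈ S ∧ y.2 ≠ s)
      (Sum.elim (fun _ => False) fun j => j ∉ S)) ?_ ?_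
  · intro t ht
    have hX : ∀ i : (Fin n × Fin n) ⊕ (Fin n ⊕ Fin n),
        MvPolynomial.monomial (Finsupp.single i 1) (1 : K) = MvPolynomial.X i := fun _ => rfl
    refine Eq.trans ?_ (eval_top_eq_zero_of_mem_kalmanIdeal h hf hW hSd hs
      (fun j hj => S.min'_le j hj) (z := fun y => t (.inl y)) (fun j => ht _)
      (fun p => t (.inr (.inl p))) (φ₀ := fun j => t (.inr (.inr j))) (fun j => ht _))
    rw [← MvPolynomial.aeval_eq_eval, ← MvPolynomial.aeval_eq_eval,
      MvPolynomial.comp_aeval_apply]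
    congr 2
    funext ⟨p, q⟩
    rw [MvPolynomial.aeval_eq_eval, rankOneExp]
    by_cases hq : (q : ℕ) < d
    · by_cases hp : (p : ℕ) < d
      · have hγ : ¬ (d ≤ (p : ℕ) ∧ (q : ℕ) < d) := by omega
        rw [if_neg hγ, hX]
        simp only [MvPolynomial.eval_X, Sum.elim_inl, hp, hq, if_true]
        congr
      · have hγ : d ≤ (p : ℕ) ∧ (q : ℕ) < d := by omega
        rw [if_pos hγ, monomial_single_add, hX]
        by_cases hqS : q ∈ S <;> simp [hp, hq, hqS]
    · have hγ : ¬ (d ≤ (p : ℕ) ∧ (q : ℕ) < d) := by omega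
      have hqS : q ∉ S := fun hqS => hq (hSd q hqS)
      rw [if_neg hγ, hX]
      simp [hq, hqS]
  · rintro (⟨p, q⟩ | p | j) hZ
    · obtain ⟨hpq, hpS, hps⟩ : p = q ∧ q ∈ S ∧ q ≠ s := hZ
      subst hpq
      by_contra h0
      obtain ⟨y, hy, hy'⟩ := content_apply_ne_zero_iff.mp h0
      obtain ⟨rfl, -⟩ := rankOneExp_inl_ne_zero_iff.mp hy'
      exact hy (hSl p hpS s hs (lt_of_le_of_ne (S.min'_le p hpS) (Ne.symm hps)))
    · exact hZ.elim
    · exact hSm j hZ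

/-- The leading monomials of the cubics reduce, modulo the cubics, to monomials of smaller
diagonal weight. -/
theorem monomial_lead_mem_sup (K : Type*) [Field K] {n d : ℕ} {p q k l : Fin n} (hp : d ≤ (p : ℕ))
    (hq : d ≤ (q : ℕ)) (hl : (l : ℕ) < d) (hkl : k < l) (m : (Fin n × Fin n) →₀ ℕ) :
    MvPolynomial.monomial (Finsupp.single (p, k) 1 + (Finsupp.single (q, l) 1 +
        (Finsupp.single (l, l) 1 + m))) (1 : K) ∈
      (cubIdeal K n d).restrictScalars K ⊔ MvPolynomial.restrictSupport K
        {m' | Finsupp.weight (diagWeight n d) m' < Finsupp.weight (diagWeight n d) m + (l + 1)} := by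
  set W := Finsupp.weight (diagWeight n d) m + ((l : ℕ) + 1)
  set R := MvPolynomial.restrictSupport K {m' | Finsupp.weight (diagWeight n d) m' < W}
  have hkl' : (k : ℕ) < l := hkl
  have hR : ∀ x y z : Fin n × Fin n, diagWeight n d x + (diagWeight n d y + diagWeight n d z) < l + 1 →
      MvPolynomial.X x * (MvPolynomial.X y * (MvPolynomial.X z *
        MvPolynomial.monomial m (1 : K))) ∈ R := by
    intro x y z hxyz
    rw [← monomial_single_add, ← monomial_single_add, ← monomial_single_add,
      MvPolynomial.monomial_mem_restrictSupport]
    left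
    simp only [Set.mem_ofPred_eq, map_add, Finsupp.weight_single, one_smul, W]
    omega
  have hγ : ∀ {p j : Fin n}, d ≤ (p : ℕ) → diagWeight n d (p, j) = 0 := by
    intro p j hp
    refine if_neg ?_
    rintro ⟨h1, h2⟩
    rw [← h1] at h2
    exact absurd h2 (not_lt.mpr hp)
  have hα : ∀ {r j : Fin n}, r ≠ j → diagWeight n d (r, j) = 0 := fun hrj => if_neg fun h => hrj h.1
  have hαle : ∀ r j : Fin n, diagWeight n d (r, j) ≤ j + 1 := by
    intro r j
    unfold diagWeight
    split_ifs <;> simp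
  have hsplit : MvPolynomial.monomial (Finsupp.single (p, k) 1 + (Finsupp.single (q, l) 1 +
        (Finsupp.single (l, l) 1 + m))) (1 : K) =
      MvPolynomial.monomial m 1 * cubGen K d p q k l +
      (MvPolynomial.X (p, l) * (MvPolynomial.X (q, l) * (MvPolynomial.X (l, k) *
          MvPolynomial.monomial m 1)) -
        ∑ r ∈ (lowIdx n d).erase l,
          (MvPolynomial.X (p, k) * (MvPolynomial.X (q, r) * (MvPolynomial.X (r, l) *
              MvPolynomial.monomial m 1)) -
            MvPolynomial.X (p, l) * (MvPolynomial.X (q, r) * (MvPolynomial.X (r, k) *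
              MvPolynomial.monomial m 1)))) := by
    rw [monomial_single_add, monomial_single_add, monomial_single_add, cubGen,
      ← Finset.add_sum_erase _ _ (mem_lowIdx.mpr hl), mul_add, Finset.mul_sum]
    have : ∀ r, MvPolynomial.monomial m (1 : K) *
        (MvPolynomial.X (p, k) * (MvPolynomial.X (q, r) * MvPolynomial.X (r, l)) -
          MvPolynomial.X (p, l) * (MvPolynomial.X (q, r) * MvPolynomial.X (r, k))) =
        MvPolynomial.X (p, k) * (MvPolynomial.X (q, r) * (MvPolynomial.X (r, l) *
              MvPolynomial.monomial m 1)) -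
            MvPolynomial.X (p, l) * (MvPolynomial.X (q, r) * (MvPolynomial.X (r, k) *
              MvPolynomial.monomial m 1)) := fun r => by ring
    simp only [this]
    ring
  rw [hsplit]
  refine Submodule.add_mem_sup ?_ (R.sub_mem (hR _ _ _ ?_) (R.sum_mem fun r hr => R.sub_mem
    (hR _ _ _ ?_) (hR _ _ _ ?_)))
  · exact Ideal.mul_mem_left _ _ (cubGen_mem_cubIdeal K hp hq (hkl'.trans hl) hl)
  · rw [hγ hp, hγ hq, hα hkl.ne']
    omega
  · rw [hγ hp, hγ hq, hα (Finset.ne_of_mem_erase hr)]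
    omega
  · rw [hγ hp, hγ hq]
    have := hαle r k
    omega

/-- A polynomial is congruent modulo the quadrics to one, with the same diagonal weights, whose
monomials have pairwise distinct contents. -/
theorem exists_injOn_content {K : Type*} [Field K] {n d : ℕ} (f : MatCoordRing K n) {W : ℕ}
    (hW : ∀ m ∈ f.support, Finsupp.weight (diagWeight n d) m ≤ W) :
    ∃ g : MatCoordRing K n, f - g ∈ quadIdeal K n d ∧
      (∀ m ∈ g.support, Finsupp.weight (diagWeight n d) m ≤ W) ∧
      Set.InjOn (content d) (g.support : Set ((Fin n × Fin n) →₀ ℕ)) := by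
  classical
  let rep : ((Fin n × Fin n) →₀ ℕ) → ((Fin n × Fin n) →₀ ℕ) :=
    fun m => Function.invFun (content d) (content d m)
  have hrep : ∀ m, content d (rep m) = content d m := fun m => Function.invFun_eq ⟨m, rfl⟩
  have hsupp : ∀ m ∈ (∑ m ∈ f.support, MvPolynomial.monomial (rep m) (f.coeff m)).support,
      ∃ m' ∈ f.support, rep m' = m := by
    intro m hm
    obtain ⟨m', hm', hmm⟩ := Finset.mem_biUnion.mp (MvPolynomial.support_sum hm)
    exact ⟨m', hm', (Finset.mem_singleton.mp (MvPolynomial.support_monomial_subset hmm)).symm⟩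
  refine ⟨∑ m ∈ f.support, MvPolynomial.monomial (rep m) (f.coeff m), ?_, fun m hm => ?_,
    fun m₁ hm₁ m₂ hm₂ heq => ?_⟩
  · nth_rewrite 1 [f.as_sum]
    rw [← Finset.sum_sub_distrib]
    refine Ideal.sum_mem _ fun m _ => ?_
    have := Ideal.mul_mem_left _ (MvPolynomial.C (f.coeff m))
      (monomial_sub_mem_quadIdeal K (hrep m).symm)
    rwa [mul_sub, MvPolynomial.C_mul_monomial, MvPolynomial.C_mul_monomial, mul_one] at this
  · obtain ⟨m', hm', rfl⟩ := hsupp m hm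
    rw [weight_diagWeight_eq_content, hrep, ← weight_diagWeight_eq_content]
    exact hW m' hm'
  · obtain ⟨m₁', -, rfl⟩ := hsupp m₁ hm₁
    obtain ⟨m₂', -, rfl⟩ := hsupp m₂ hm₂
    rw [hrep, hrep] at heq
    exact congrArg (Function.invFun (content d)) heq

theorem kalmanIdeal_eq (K : Type*) [Field K] [Infinite K] {n d : ℕ} (hd : 2 ≤ d) (h : d ≤ n) :
    kalmanIdeal K n d (d - 1) = quadIdeal K n d ⊔ cubIdeal K n d := by
  have hle := quadIdeal_sup_cubIdeal_le (K := K) hd h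
  refine le_antisymm ?_ hle
  suffices hmain : ∀ W : ℕ, ∀ f ∈ kalmanIdeal K n d (d - 1),
      (∀ m ∈ f.support, Finsupp.weight (diagWeight n d) m < W) →
      f ∈ quadIdeal K n d ⊔ cubIdeal K n d from fun f hf =>
    hmain (f.support.sup (Finsupp.weight (diagWeight n d)) + 1) f hf fun m hm =>
      Nat.lt_succ_of_le (Finset.le_sup (f := Finsupp.weight (diagWeight n d)) hm)
  intro W
  induction W with
  | zero =>
    intro f _ hW
    have : f = 0 := by
      by_contra hne
      obtain ⟨m, hm⟩ := Finset.nonempty_of_ne_empty (mt MvPolynomial.support_eq_empty.mp hne)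
      exact Nat.not_lt_zero _ (hW m hm)
    rw [this]
    exact Ideal.zero_mem _
  | succ W ih =>
    intro f hf hW
    obtain ⟨g, hfg, hgW, hinj⟩ := exists_injOn_content f fun m hm => Nat.le_of_lt_succ (hW m hm)
    have hfg' : f - g ∈ quadIdeal K n d ⊔ cubIdeal K n d := Ideal.mem_sup_left hfg
    have hg : g ∈ kalmanIdeal K n d (d - 1) := by
      have := Ideal.sub_mem _ hf (hle hfg')
      rwa [sub_sub_cancel] at this
    have hgmem : g ∈ (cubIdeal K n d).restrictScalars K ⊔ MvPolynomial.restrictSupport K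
        {m | Finsupp.weight (diagWeight n d) m < W} := by
      rw [g.as_sum]
      refine Submodule.sum_mem _ fun m hm => ?_
      rw [← mul_one (g.coeff m), ← smul_eq_mul, ← MvPolynomial.smul_monomial]
      refine Submodule.smul_mem _ _ ?_
      rcases (hgW m hm).lt_or_eq with hlt | heq
      · exact Submodule.mem_sup_right
          ((MvPolynomial.monomial_mem_restrictSupport K).mpr (Or.inl hlt))
      · obtain ⟨p, q, k, l, m₁, hp, hq, hl, hkl, rfl⟩ :=
          exists_lead_of_mem_kalmanIdeal (by omega) h hg hgW hinj hm heq
        have := monomial_lead_mem_sup K hp hq hl hkl m₁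
        convert this using 6
        have hpk : p ≠ k := by
          rintro rfl
          omega
        have hql : q ≠ l := by
          rintro rfl
          omega
        simp only [map_add, Finsupp.weight_single, one_smul, diagWeight, hpk, hql, hl, false_and,
          if_false, and_self, if_true] at heq
        omega
    obtain ⟨c, hc, r, hr, rfl⟩ := Submodule.mem_sup.mp hgmem
    have hc' : c ∈ quadIdeal K n d ⊔ cubIdeal K n d := Ideal.mem_sup_right hc
    have hrmem := ih r ((Ideal.add_mem_iff_right _ (hle hc')).mp hg)
      fun m hm => (MvPolynomial.mem_restrictSupport_iff K).mp hr hm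
    have := Ideal.add_mem _ hfg' (Ideal.add_mem _ hc' hrmem)
    rwa [sub_add_cancel] at this

theorem homogeneousComponent_mul_of_isHomogeneous {K σ : Type*} [Field K] {g : MvPolynomial σ K}
    {e j : ℕ} (hg : g.IsHomogeneous e) (hj : e ≤ j) (a : MvPolynomial σ K) :
    MvPolynomial.homogeneousComponent j (a * g) =
      MvPolynomial.homogeneousComponent (j - e) a * g := by
  classical
  let := MvPolynomial.gradedAlgebra (σ := σ) (R := K)
  have := DirectSum.coe_decompose_mul_of_right_mem_of_le
    (MvPolynomial.homogeneousSubmodule σ K) (a := a) hg hj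
  rwa [← MvPolynomial.decomposition.decompose'_apply,
    ← MvPolynomial.decomposition.decompose'_apply]

theorem mem_pow_idealOfVars_of_isHomogeneous {K σ : Type*} [Field K] {g : MvPolynomial σ K}
    {e : ℕ} (hg : g.IsHomogeneous e) : g ∈ MvPolynomial.idealOfVars σ K ^ e := by
  rw [MvPolynomial.mem_pow_idealOfVars_iff']
  exact fun x hx => hg.coeff_eq_zero hx.ne

theorem homogeneousComponent_eq_zero_of_mem_pow {K σ : Type*} [Field K] {f : MvPolynomial σ K}
    {e j : ℕ} (hf : f ∈ MvPolynomial.idealOfVars σ K ^ e) (hj : j < e) :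
    MvPolynomial.homogeneousComponent j f = 0 := by
  classical
  rw [MvPolynomial.mem_pow_idealOfVars_iff'] at hf
  ext m
  rw [MvPolynomial.coeff_homogeneousComponent, MvPolynomial.coeff_zero]
  split_ifs with h
  · exact hf m (h ▸ hj)
  · rfl

/-- The graded pieces of an ideal generated by forms of degree `e`. -/
theorem homogeneousComponent_mem_of_mem_span {K σ : Type*} [Field K] {G : Set (MvPolynomial σ K)}
    {e : ℕ} (hG : ∀ g ∈ G, g.IsHomogeneous e) {f : MvPolynomial σ K} (hf : f ∈ Ideal.span G) :
    MvPolynomial.homogeneousComponent e f ∈ Submodule.span K G ∧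
      ∀ j, e < j → MvPolynomial.homogeneousComponent j f ∈
        MvPolynomial.idealOfVars σ K * Ideal.span G := by
  induction hf using Submodule.closure_induction with
  | zero => simp
  | add x y _ _ hx hy =>
    simp only [map_add]
    exact ⟨add_mem hx.1 hy.1, fun j hj => add_mem (hx.2 j hj) (hy.2 j hj)⟩
  | smul_mem r g hg =>
    refine ⟨?_, fun j hj => ?_⟩
    · rw [smul_eq_mul, homogeneousComponent_mul_of_isHomogeneous (hG g hg) le_rfl, Nat.sub_self,
        MvPolynomial.homogeneousComponent_zero, ← MvPolynomial.smul_eq_C_mul]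
      exact Submodule.smul_mem _ _ (Submodule.subset_span hg)
    · rw [smul_eq_mul, homogeneousComponent_mul_of_isHomogeneous (hG g hg) hj.le]
      refine Ideal.mul_mem_mul ?_ (Ideal.subset_span hg)
      have := mem_pow_idealOfVars_of_isHomogeneous
        (MvPolynomial.homogeneousComponent_isHomogeneous (j - e) r)
      exact Ideal.pow_le_self (by omega) this

theorem isHomogeneous_quadGen (K : Type*) [Field K] {n : ℕ} (p q k l : Fin n) :
    (quadGen K p q k l).IsHomogeneous 2 :=
  ((MvPolynomial.isHomogeneous_X _ _).mul (MvPolynomial.isHomogeneous_X _ _)).sub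
    ((MvPolynomial.isHomogeneous_X _ _).mul (MvPolynomial.isHomogeneous_X _ _))

theorem isHomogeneous_cubGen (K : Type*) [Field K] {n : ℕ} (d : ℕ) (p q k l : Fin n) :
    (cubGen K d p q k l).IsHomogeneous 3 :=
  MvPolynomial.IsHomogeneous.sum _ _ _ fun _ _ =>
    ((MvPolynomial.isHomogeneous_X _ _).mul ((MvPolynomial.isHomogeneous_X _ _).mul
      (MvPolynomial.isHomogeneous_X _ _))).sub
    ((MvPolynomial.isHomogeneous_X _ _).mul ((MvPolynomial.isHomogeneous_X _ _).mul
      (MvPolynomial.isHomogeneous_X _ _)))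

theorem quadIdeal_le_pow (K : Type*) [Field K] (n d : ℕ) :
    quadIdeal K n d ≤ irrelevantIdeal K n ^ 2 := by
  refine Ideal.span_le.mpr ?_
  rintro _ ⟨p, q, k, l, -, -, -, -, rfl⟩
  exact mem_pow_idealOfVars_of_isHomogeneous (isHomogeneous_quadGen K p q k l)

theorem cubIdeal_le_pow (K : Type*) [Field K] (n d : ℕ) :
    cubIdeal K n d ≤ irrelevantIdeal K n ^ 3 := by
  refine Ideal.span_le.mpr ?_
  rintro _ ⟨p, q, k, l, -, -, -, -, rfl⟩
  exact mem_pow_idealOfVars_of_isHomogeneous (isHomogeneous_cubGen K d p q k l)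

theorem homogeneousComponent_mem_of_mem_quadIdeal {K : Type*} [Field K] {n d : ℕ}
    {f : MatCoordRing K n} (hf : f ∈ quadIdeal K n d) :
    MvPolynomial.homogeneousComponent 2 f ∈ Submodule.span K {f | ∃ p q k l : Fin n,
        d ≤ (p : ℕ) ∧ d ≤ (q : ℕ) ∧ (k : ℕ) < d ∧ (l : ℕ) < d ∧ f = quadGen K p q k l} ∧
      ∀ j, 2 < j → MvPolynomial.homogeneousComponent j f ∈
        irrelevantIdeal K n * quadIdeal K n d := by
  refine homogeneousComponent_mem_of_mem_span ?_ hf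
  rintro _ ⟨p, q, k, l, -, -, -, -, rfl⟩
  exact isHomogeneous_quadGen K p q k l

theorem homogeneousComponent_mem_of_mem_cubIdeal {K : Type*} [Field K] {n d : ℕ}
    {f : MatCoordRing K n} (hf : f ∈ cubIdeal K n d) :
    MvPolynomial.homogeneousComponent 3 f ∈ Submodule.span K {f | ∃ p q k l : Fin n,
        d ≤ (p : ℕ) ∧ d ≤ (q : ℕ) ∧ (k : ℕ) < d ∧ (l : ℕ) < d ∧ f = cubGen K d p q k l} ∧
      ∀ j, 3 < j → MvPolynomial.homogeneousComponent j f ∈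
        irrelevantIdeal K n * cubIdeal K n d := by
  refine homogeneousComponent_mem_of_mem_span ?_ hf
  rintro _ ⟨p, q, k, l, -, -, -, -, rfl⟩
  exact isHomogeneous_cubGen K d p q k l

theorem irrelevantIdeal_mul_homogeneousComponent_three {K : Type*} [Field K] {n d : ℕ}
    {f : MatCoordRing K n}
    (hf : f ∈ irrelevantIdeal K n * (quadIdeal K n d ⊔ cubIdeal K n d)) :
    MvPolynomial.homogeneousComponent 3 f ∈ quadIdeal K n d := by
  rw [Ideal.mul_sup] at hf
  obtain ⟨a, ha, c, hc, rfl⟩ := Submodule.mem_sup.mp hf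
  have hc' : c ∈ irrelevantIdeal K n ^ 4 := by
    rw [pow_succ']
    exact Ideal.mul_mono_right (cubIdeal_le_pow K n d) hc
  have hc0 := homogeneousComponent_eq_zero_of_mem_pow (j := 3) hc' (by norm_num)
  rw [map_add, hc0, add_zero]
  exact Ideal.mul_le_right ((homogeneousComponent_mem_of_mem_quadIdeal
    (Ideal.mul_le_right ha)).2 3 (by norm_num))

theorem gradedPiece_mono (K : Type*) [Field K] {n : ℕ} {I J : Ideal (MatCoordRing K n)}
    (h : I ≤ J) (j : ℕ) : gradedPiece K n I j ≤ gradedPiece K n J j :=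
  inf_le_inf_right _ h

/-- Forms spanning a graded piece of `J` together with `A₊ J`, and independent modulo `A₊ J`,
count the minimal generators in that degree. -/
theorem minGens_eq_card {K : Type*} [Field K] {n j : ℕ} {J : Ideal (MatCoordRing K n)}
    {ι : Type*} [Fintype ι] [DecidableEq ι] (b : ι → MatCoordRing K n)
    (ψ : ι → MatCoordRing K n →ₗ[K] K) (hb : ∀ i, b i ∈ gradedPiece K n J j)
    (hspan : ∀ f ∈ gradedPiece K n J j, f ∈ gradedPiece K n (irrelevantIdeal K n * J) j ⊔
      Submodule.span K (Set.range b))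
    (hψb : ∀ i i', ψ i (b i') = if i' = i then 1 else 0)
    (hψ : ∀ i, ∀ f ∈ gradedPiece K n (irrelevantIdeal K n * J) j, ψ i f = 0) :
    minGens K n J j = Fintype.card ι := by
  have heq : gradedPiece K n J j = gradedPiece K n (irrelevantIdeal K n * J) j ⊔
      Submodule.span K (Set.range b) :=
    le_antisymm hspan (sup_le (gradedPiece_mono K Ideal.mul_le_right j)
      (Submodule.span_le.mpr (Set.range_subset_iff.mpr hb)))
  have hfin : FiniteDimensional K (gradedPiece K n (irrelevantIdeal K n * J) j) := by
    have := Module.Finite.iff_fg.mpr (MvPolynomial.homogeneousSubmodule_fg (Fin n × Fin n) K j)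
    exact Submodule.finiteDimensional_of_le inf_le_right
  have hdisj : gradedPiece K n (irrelevantIdeal K n * J) j ⊓ Submodule.span K (Set.range b) = ⊥ := by
    refine (Submodule.eq_bot_iff _).mpr ?_
    rintro f ⟨hf, hfb⟩
    obtain ⟨c, rfl⟩ := (Submodule.mem_span_range_iff_exists_fun K).mp hfb
    refine Finset.sum_eq_zero fun i _ => ?_
    have := hψ i _ hf
    simp only [map_sum, map_smul, hψb, smul_eq_mul, mul_ite, mul_one, mul_zero,
      Finset.sum_ite_eq', Finset.mem_univ, if_true] at this
    rw [this, zero_smul]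
  have hli : LinearIndependent K b :=
    LinearIndependent.of_pairwise_dual_eq_zero_one b ψ
      (fun i i' hne => by simp only [hψb, if_neg hne.symm]) fun i => by simp [hψb]
  have : FiniteDimensional K (Submodule.span K (Set.range b)) :=
    FiniteDimensional.span_of_finite K (Set.finite_range b)
  have hrank := Submodule.finrank_sup_add_finrank_inf_eq
    (gradedPiece K n (irrelevantIdeal K n * J) j) (Submodule.span K (Set.range b))
  rw [← heq, hdisj, finrank_bot, finrank_span_eq_card hli] at hrank
  rw [minGens]
  omega

theorem card_filter_fst_lt_snd {α : Type*} [LinearOrder α] (s : Finset α) :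
    ((s ×ˢ s).filter fun x => x.1 < x.2).card = s.card.choose 2 := by
  induction s using Finset.induction_on_max with
  | empty => simp
  | insert a s ha ih =>
    have ha' : a ∉ s := fun h => lt_irrefl a (ha a h)
    have : ((insert a s ×ˢ insert a s).filter fun x => x.1 < x.2) =
        ((s ×ˢ s).filter fun x => x.1 < x.2) ∪ s ×ˢ {a} := by
      ext ⟨x, y⟩
      simp only [Finset.mem_filter, Finset.mem_product, Finset.mem_insert, Finset.mem_union,
        Finset.mem_singleton]
      constructor
      · rintro ⟨⟨rfl | hx, rfl | hy⟩, hxy⟩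
        · exact absurd hxy (lt_irrefl _)
        · exact absurd hxy (ha y hy).not_gt
        · exact Or.inr ⟨hx, rfl⟩
        · exact Or.inl ⟨⟨hx, hy⟩, hxy⟩
      · rintro (⟨⟨hx, hy⟩, hxy⟩ | ⟨hx, rfl⟩)
        · exact ⟨⟨Or.inr hx, Or.inr hy⟩, hxy⟩
        · exact ⟨⟨Or.inr hx, Or.inl rfl⟩, ha x hx⟩
    rw [this, Finset.card_union_of_disjoint, ih, Finset.card_product, Finset.card_singleton,
      Finset.card_insert_of_notMem ha', Nat.choose_succ_succ' s.card 1, Nat.choose_one_right]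
    · ring
    · refine Finset.disjoint_left.mpr ?_
      rintro ⟨x, y⟩ h1 h2
      simp only [Finset.mem_filter, Finset.mem_product, Finset.mem_singleton] at h1 h2
      exact ha' (h2.2 ▸ h1.1.2)

theorem card_filter_fst_le_snd {α : Type*} [LinearOrder α] (s : Finset α) :
    ((s ×ˢ s).filter fun x => x.1 ≤ x.2).card = (s.card + 1).choose 2 := by
  have : ((s ×ˢ s).filter fun x => x.1 ≤ x.2) =
      ((s ×ˢ s).filter fun x => x.1 < x.2) ∪ s.diag := by
    ext ⟨x, y⟩
    simp only [Finset.mem_filter, Finset.mem_product, Finset.mem_union, Finset.mem_diag,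
      le_iff_lt_or_eq]
    constructor
    · rintro ⟨h, hxy | rfl⟩
      · exact Or.inl ⟨h, hxy⟩
      · exact Or.inr ⟨h.1, rfl⟩
    · rintro (⟨h, hxy⟩ | ⟨h, rfl⟩)
      · exact ⟨h, Or.inl hxy⟩
      · exact ⟨⟨h, h⟩, Or.inr rfl⟩
  rw [this, Finset.card_union_of_disjoint, card_filter_fst_lt_snd, Finset.diag_card,
    Nat.choose_succ_succ' s.card 1, Nat.choose_one_right, add_comm]
  refine Finset.disjoint_left.mpr ?_
  rintro ⟨x, y⟩ h1 h2
  simp only [Finset.mem_filter, Finset.mem_diag] at h1 h2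
  exact h1.2.ne h2.2

theorem card_lowIdx {n d : ℕ} (h : d ≤ n) : (lowIdx n d).card = d := by
  rw [lowIdx, Fin.card_filter_val_lt, min_eq_right h]

theorem card_compl_lowIdx {n d : ℕ} (h : d ≤ n) : (lowIdx n d)ᶜ.card = n - d := by
  rw [Finset.card_compl, card_lowIdx h, Fintype.card_fin]

/-- Two unordered pairs with the same multiset of elements agree once they are sorted. -/
theorem eq_of_single_add_single_eq {α : Type*} [LinearOrder α] {a b c d : α} (hab : a ≤ b)
    (hcd : c ≤ d)
    (h : Finsupp.single a 1 + Finsupp.single b 1 = Finsupp.single c 1 + Finsupp.single d (1 : ℕ)) :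
    a = c ∧ b = d := by
  rcases (Finsupp.single_add_single_eq_single_add_single one_ne_zero one_ne_zero).mp h with
    h | ⟨-, rfl, rfl⟩ | ⟨h0, -⟩
  · exact h
  · exact ⟨le_antisymm hab hcd, le_antisymm hcd hab⟩
  · exact absurd h0 (by norm_num)

theorem quadGen_mem_of_lt {K : Type*} [Field K] {n d : ℕ} {V : Submodule K (MatCoordRing K n)}
    (hV : ∀ p q k l : Fin n, d ≤ (p : ℕ) → p < q → (l : ℕ) < d → k < l → quadGen K p q k l ∈ V)
    {p q k l : Fin n} (hp : d ≤ (p : ℕ)) (hq : d ≤ (q : ℕ)) (hk : (k : ℕ) < d)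
    (hl : (l : ℕ) < d) : quadGen K p q k l ∈ V := by
  have hV' : ∀ p q : Fin n, d ≤ (p : ℕ) → p < q → quadGen K p q k l ∈ V := by
    intro p q hp hpq
    rcases lt_trichotomy k l with hkl | rfl | hkl
    · exact hV p q k l hp hpq hl hkl
    · convert V.zero_mem using 1
      rw [quadGen]
      ring
    · convert V.neg_mem (hV p q l k hp hpq hk hkl) using 1
      rw [quadGen, quadGen]
      ring
  rcases lt_trichotomy p q with hpq | rfl | hpq
  · exact hV' p q hp hpq
  · convert V.zero_mem using 1
    rw [quadGen]
    ring
  · convert V.neg_mem (hV' q p hq hpq) using 1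
    rw [quadGen, quadGen]
    ring

theorem cubGen_sub_cubGen {K : Type*} [Field K] {n d : ℕ} (p q k l : Fin n) :
    cubGen K d p q k l - cubGen K d q p k l = ∑ r ∈ lowIdx n d,
      (MvPolynomial.X (r, l) * quadGen K p q k r - MvPolynomial.X (r, k) * quadGen K p q l r) := by
  rw [cubGen, cubGen, ← Finset.sum_sub_distrib]
  refine Finset.sum_congr rfl fun r _ => ?_
  rw [quadGen, quadGen]
  ring

theorem cubGen_mem_of_le {K : Type*} [Field K] {n d : ℕ} {V : Submodule K (MatCoordRing K n)}
    (hQ : gradedPiece K n (irrelevantIdeal K n * quadIdeal K n d) 3 ≤ V)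
    (hV : ∀ p q k l : Fin n, d ≤ (p : ℕ) → p ≤ q → (l : ℕ) < d → k < l → cubGen K d p q k l ∈ V)
    {p q k l : Fin n} (hp : d ≤ (p : ℕ)) (hq : d ≤ (q : ℕ)) (hk : (k : ℕ) < d)
    (hl : (l : ℕ) < d) : cubGen K d p q k l ∈ V := by
  have hV' : ∀ p q : Fin n, d ≤ (p : ℕ) → p ≤ q → cubGen K d p q k l ∈ V := by
    intro p q hp hpq
    rcases lt_trichotomy k l with hkl | rfl | hkl
    · exact hV p q k l hp hpq hl hkl
    · convert V.zero_mem using 1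
      simp [cubGen]
    · convert V.neg_mem (hV p q l k hp hpq hk hkl) using 1
      simp [cubGen]
  rcases le_total p q with hpq | hpq
  · exact hV' p q hp hpq
  · rw [← sub_add_cancel (cubGen K d p q k l) (cubGen K d q p k l)]
    refine V.add_mem (hQ ⟨?_, (isHomogeneous_cubGen K d p q k l).sub
      (isHomogeneous_cubGen K d q p k l)⟩) (hV' q p hq hpq)
    rw [cubGen_sub_cubGen]
    refine Ideal.sum_mem _ fun r hr => ?_
    have hr' := mem_lowIdx.mp hr
    exact Ideal.sub_mem _
      (Ideal.mul_mem_mul (Ideal.subset_span ⟨_, rfl⟩) (quadGen_mem_quadIdeal K hp hq hk hr'))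
      (Ideal.mul_mem_mul (Ideal.subset_span ⟨_, rfl⟩) (quadGen_mem_quadIdeal K hp hq hl hr'))

theorem coeff_single_add_single_X_mul_X {K σ : Type*} [Field K] [DecidableEq σ] (x y a b : σ) :
    MvPolynomial.coeff (Finsupp.single x 1 + Finsupp.single y 1)
      (MvPolynomial.X a * MvPolynomial.X b : MvPolynomial σ K) =
      if Finsupp.single a 1 + Finsupp.single b 1 =
        Finsupp.single x 1 + Finsupp.single y (1 : ℕ) then 1 else 0 := by
  rw [MvPolynomial.X, MvPolynomial.X, MvPolynomial.monomial_mul, one_mul,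
    MvPolynomial.coeff_monomial]

theorem coeff_quadGen {K : Type*} [Field K] {n : ℕ} {p q k l p' q' k' l' : Fin n} (hpq : p < q)
    (hkl : k < l) (hpq' : p' < q') (hkl' : k' < l') :
    MvPolynomial.coeff (Finsupp.single (p, k) 1 + Finsupp.single (q, l) 1)
      (quadGen K p' q' k' l') = if ((p', q'), (k', l')) = ((p, q), (k, l)) then 1 else 0 := by
  classical
  have h1 : Finsupp.single (p', k') 1 + Finsupp.single (q', l') 1 =
      Finsupp.single (p, k) 1 + Finsupp.single (q, l) (1 : ℕ) ↔
        ((p', q'), (k', l')) = ((p, q), (k, l)) := by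
    rw [Finsupp.single_add_single_eq_single_add_single one_ne_zero one_ne_zero]
    simp only [Prod.mk.injEq]
    constructor
    · rintro (⟨⟨rfl, rfl⟩, rfl, rfl⟩ | ⟨-, ⟨rfl, rfl⟩, rfl, rfl⟩ | ⟨h0, -⟩)
      · exact ⟨⟨rfl, rfl⟩, rfl, rfl⟩
      · exact absurd hpq hpq'.not_gt
      · exact absurd h0 (by norm_num)
    · rintro ⟨⟨rfl, rfl⟩, rfl, rfl⟩
      exact Or.inl ⟨⟨rfl, rfl⟩, rfl, rfl⟩
  have h2 : ¬ Finsupp.single (p', l') 1 + Finsupp.single (q', k') 1 =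
      Finsupp.single (p, k) 1 + Finsupp.single (q, l) (1 : ℕ) := by
    rw [Finsupp.single_add_single_eq_single_add_single one_ne_zero one_ne_zero]
    simp only [Prod.mk.injEq]
    rintro (⟨⟨rfl, rfl⟩, rfl, rfl⟩ | ⟨-, ⟨rfl, rfl⟩, rfl, rfl⟩ | ⟨h0, -⟩)
    · exact hkl.not_gt hkl'
    · exact hpq.not_gt hpq'
    · exact absurd h0 (by norm_num)
  rw [quadGen, MvPolynomial.coeff_sub, coeff_single_add_single_X_mul_X,
    coeff_single_add_single_X_mul_X, if_neg h2, sub_zero]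
  exact if_congr h1 rfl rfl

/-- The substitution that specializes the block `γ` to `v (e_k + e_l)ᵀ`, with `v` generic, and all
other entries to zero except for the `l`-th diagonal one, which becomes `1`. -/
noncomputable def rankOneHom (K : Type*) [Field K] (n d : ℕ) (k l : Fin n) :
    MatCoordRing K n →ₐ[K] MvPolynomial (Fin n) K :=
  MvPolynomial.aeval fun x =>
    if (x.1 : ℕ) < d then if x.1 = l ∧ x.2 = l then 1 else 0
    else if x.2 = k ∨ x.2 = l then MvPolynomial.X x.1 else 0

theorem rankOneHom_eq_zero_of_mem_quadIdeal {K : Type*} [Field K] {n d : ℕ} (k l : Fin n)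
    {f : MatCoordRing K n} (hf : f ∈ quadIdeal K n d) : rankOneHom K n d k l f = 0 := by
  suffices h : quadIdeal K n d ≤ RingHom.ker (rankOneHom K n d k l) from h hf
  refine Ideal.span_le.mpr ?_
  rintro _ ⟨p, q, k', l', hp, hq, -, -, rfl⟩
  simp only [SetLike.mem_coe, RingHom.mem_ker, quadGen, rankOneHom, map_sub, map_mul,
    MvPolynomial.aeval_X, hp.not_gt, hq.not_gt, if_false]
  split_ifs <;> ring

theorem rankOneHom_cubGen {K : Type*} [Field K] {n d : ℕ} {p q k l k' l' : Fin n}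
    (hp : d ≤ (p : ℕ)) (hq : d ≤ (q : ℕ)) (hl : (l : ℕ) < d) (hkl : k < l) (hkl' : k' < l') :
    rankOneHom K n d k l (cubGen K d p q k' l') =
      if (k', l') = (k, l) then MvPolynomial.X p * MvPolynomial.X q else 0 := by
  rw [cubGen, map_sum, Finset.sum_eq_single_of_mem l (mem_lowIdx.mpr hl)]
  · simp only [rankOneHom, map_sub, map_mul, MvPolynomial.aeval_X, hp.not_gt, hq.not_gt, hl,
      if_false, if_true, or_true, true_and, Prod.mk.injEq]
    by_cases h1 : l' = l
    · subst h1
      simp [hkl'.ne, hkl.ne']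
    · by_cases h2 : k' = l
      · subst h2
        simp [h1, (hkl.trans hkl').ne']
      · simp [h1, h2]
  · intro r hr hrl
    simp only [rankOneHom, map_sub, map_mul, MvPolynomial.aeval_X, mem_lowIdx.mp hr, if_true, hrl,
      false_and, if_false, mul_zero, sub_zero]

section MinimalGenerators

variable (K : Type*) [Field K] {n d : ℕ}

theorem minGens_two (h : d ≤ n) :
    minGens K n (quadIdeal K n d ⊔ cubIdeal K n d) 2 = d.choose 2 * (n - d).choose 2 := by
  let ι := {x // x ∈ (((lowIdx n d)ᶜ ×ˢ (lowIdx n d)ᶜ).filter fun x => x.1 < x.2) ×ˢ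
    ((lowIdx n d ×ˢ lowIdx n d).filter fun x => x.1 < x.2)}
  have hι : ∀ i : ι, d ≤ (i.1.1.1 : ℕ) ∧ d ≤ (i.1.1.2 : ℕ) ∧ i.1.1.1 < i.1.1.2 ∧
      (i.1.2.1 : ℕ) < d ∧ (i.1.2.2 : ℕ) < d ∧ i.1.2.1 < i.1.2.2 := by
    rintro ⟨⟨⟨p, q⟩, k, l⟩, hi⟩
    simp only [Finset.mem_product, Finset.mem_filter, Finset.mem_compl, mem_lowIdx, not_lt] at hi
    exact ⟨hi.1.1.1, hi.1.1.2, hi.1.2, hi.2.1.1, hi.2.1.2, hi.2.2⟩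
  have hcard : Fintype.card ι = d.choose 2 * (n - d).choose 2 := by
    rw [Fintype.card_coe, Finset.card_product, card_filter_fst_lt_snd, card_filter_fst_lt_snd,
      card_lowIdx h, card_compl_lowIdx h, mul_comm]
  rw [← hcard]
  refine minGens_eq_card (fun i : ι => quadGen K i.1.1.1 i.1.1.2 i.1.2.1 i.1.2.2)
    (fun i => MvPolynomial.lcoeff K
      (Finsupp.single (i.1.1.1, i.1.2.1) 1 + Finsupp.single (i.1.1.2, i.1.2.2) 1)) ?_ ?_ ?_ ?_
  · intro i
    obtain ⟨hp, hq, -, hk, hl, -⟩ := hι i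
    exact ⟨Ideal.mem_sup_left (quadGen_mem_quadIdeal K hp hq hk hl), isHomogeneous_quadGen K _ _ _ _⟩
  · rintro f ⟨hf, hf2⟩
    obtain ⟨a, ha, c, hc, rfl⟩ := Submodule.mem_sup.mp hf
    have hc0 := homogeneousComponent_eq_zero_of_mem_pow (cubIdeal_le_pow K n d hc)
      (show 2 < 3 by norm_num)
    refine Submodule.mem_sup_right ?_
    rw [← MvPolynomial.homogeneousComponent_eq_self hf2, map_add, hc0, add_zero]
    refine Submodule.span_le.mpr ?_ (homogeneousComponent_mem_of_mem_quadIdeal ha).1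
    rintro _ ⟨p, q, k, l, hp, hq, hk, hl, rfl⟩
    refine quadGen_mem_of_lt (fun p q k l hp hpq hl hkl => Submodule.subset_span ?_) hp hq hk hl
    have hpq' : (p : ℕ) < q := hpq
    have hkl' : (k : ℕ) < l := hkl
    refine ⟨⟨((p, q), (k, l)), ?_⟩, rfl⟩
    simp only [Finset.mem_product, Finset.mem_filter, Finset.mem_compl, mem_lowIdx]
    omega
  · intro i i'
    rw [MvPolynomial.lcoeff_apply, coeff_quadGen (hι i).2.2.1 (hι i).2.2.2.2.2 (hι i').2.2.1
      (hι i').2.2.2.2.2]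
    exact if_congr Subtype.ext_iff.symm rfl rfl
  · rintro i f ⟨hf, hf2⟩
    have hf3 : f ∈ irrelevantIdeal K n ^ 3 := by
      rw [pow_succ']
      refine Ideal.mul_mono_right (sup_le (quadIdeal_le_pow K n d) ?_) hf
      exact (cubIdeal_le_pow K n d).trans (Ideal.pow_le_pow_right (by norm_num))
    have hf0 := homogeneousComponent_eq_zero_of_mem_pow hf3 (show 2 < 3 by norm_num)
    rw [MvPolynomial.homogeneousComponent_eq_self hf2] at hf0
    rw [hf0, map_zero]

theorem minGens_three (h : d ≤ n) :
    minGens K n (quadIdeal K n d ⊔ cubIdeal K n d) 3 = d.choose 2 * (n - d + 1).choose 2 := by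
  let ι := {x // x ∈ (((lowIdx n d)ᶜ ×ˢ (lowIdx n d)ᶜ).filter fun x => x.1 ≤ x.2) ×ˢ
    ((lowIdx n d ×ˢ lowIdx n d).filter fun x => x.1 < x.2)}
  have hι : ∀ i : ι, d ≤ (i.1.1.1 : ℕ) ∧ d ≤ (i.1.1.2 : ℕ) ∧ i.1.1.1 ≤ i.1.1.2 ∧
      (i.1.2.1 : ℕ) < d ∧ (i.1.2.2 : ℕ) < d ∧ i.1.2.1 < i.1.2.2 := by
    rintro ⟨⟨⟨p, q⟩, k, l⟩, hi⟩
    simp only [Finset.mem_product, Finset.mem_filter, Finset.mem_compl, mem_lowIdx, not_lt] at hi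
    exact ⟨hi.1.1.1, hi.1.1.2, hi.1.2, hi.2.1.1, hi.2.1.2, hi.2.2⟩
  have hcard : Fintype.card ι = d.choose 2 * (n - d + 1).choose 2 := by
    rw [Fintype.card_coe, Finset.card_product, card_filter_fst_le_snd, card_filter_fst_lt_snd,
      card_lowIdx h, card_compl_lowIdx h, mul_comm]
  rw [← hcard]
  refine minGens_eq_card (fun i : ι => cubGen K d i.1.1.1 i.1.1.2 i.1.2.1 i.1.2.2)
    (fun i => (MvPolynomial.lcoeff K
      (Finsupp.single i.1.1.1 1 + Finsupp.single i.1.1.2 1)).comp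
        (rankOneHom K n d i.1.2.1 i.1.2.2).toLinearMap) ?_ ?_ ?_ ?_
  · intro i
    obtain ⟨hp, hq, -, hk, hl, -⟩ := hι i
    exact ⟨Ideal.mem_sup_right (cubGen_mem_cubIdeal K hp hq hk hl),
      isHomogeneous_cubGen K _ _ _ _ _⟩
  · rintro f ⟨hf, hf3⟩
    obtain ⟨a, ha, c, hc, rfl⟩ := Submodule.mem_sup.mp hf
    have hQ : gradedPiece K n (irrelevantIdeal K n * quadIdeal K n d) 3 ≤
        gradedPiece K n (irrelevantIdeal K n * (quadIdeal K n d ⊔ cubIdeal K n d)) 3 :=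
      gradedPiece_mono K (Ideal.mul_mono_right le_sup_left) 3
    rw [← MvPolynomial.homogeneousComponent_eq_self hf3, map_add]
    refine Submodule.add_mem _ (Submodule.mem_sup_left (hQ
      ⟨(homogeneousComponent_mem_of_mem_quadIdeal ha).2 3 (by norm_num),
        MvPolynomial.homogeneousComponent_isHomogeneous _ _⟩)) ?_
    refine Submodule.span_le.mpr ?_ (homogeneousComponent_mem_of_mem_cubIdeal hc).1
    rintro _ ⟨p, q, k, l, hp, hq, hk, hl, rfl⟩
    refine cubGen_mem_of_le (hQ.trans le_sup_left) (fun p q k l hp hpq hl hkl =>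
      Submodule.mem_sup_right (Submodule.subset_span ?_)) hp hq hk hl
    have hpq' : (p : ℕ) ≤ q := hpq
    have hkl' : (k : ℕ) < l := hkl
    refine ⟨⟨((p, q), (k, l)), ?_⟩, rfl⟩
    simp only [Finset.mem_product, Finset.mem_filter, Finset.mem_compl, mem_lowIdx]
    omega
  · intro i i'
    obtain ⟨hp, hq, hpq, -, -, hkl⟩ := hι i'
    rw [LinearMap.comp_apply, AlgHom.toLinearMap_apply,
      rankOneHom_cubGen hp hq (hι i).2.2.2.2.1 (hι i).2.2.2.2.2 hkl, MvPolynomial.lcoeff_apply]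
    by_cases h2 : i'.1.2 = i.1.2
    · rw [if_pos h2, coeff_single_add_single_X_mul_X]
      refine if_congr ⟨fun h1 => ?_, fun h1 => by rw [h1]⟩ rfl rfl
      obtain ⟨hp', hq'⟩ := eq_of_single_add_single_eq hpq (hι i).2.2.1 h1
      exact Subtype.ext (Prod.ext (Prod.ext hp' hq') h2)
    · rw [if_neg h2, MvPolynomial.coeff_zero, if_neg fun h1 => h2 (by rw [h1])]
  · rintro i f ⟨hf, hf3⟩
    have hfQ := irrelevantIdeal_mul_homogeneousComponent_three hf
    rw [MvPolynomial.homogeneousComponent_eq_self hf3] at hfQ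
    rw [LinearMap.comp_apply, AlgHom.toLinearMap_apply,
      rankOneHom_eq_zero_of_mem_quadIdeal _ _ hfQ, map_zero]

theorem minGens_eq_zero {j : ℕ} (hj2 : j ≠ 2) (hj3 : j ≠ 3) :
    minGens K n (quadIdeal K n d ⊔ cubIdeal K n d) j = 0 := by
  suffices hle : gradedPiece K n (quadIdeal K n d ⊔ cubIdeal K n d) j ≤
      gradedPiece K n (irrelevantIdeal K n * (quadIdeal K n d ⊔ cubIdeal K n d)) j by
    rw [minGens, le_antisymm hle (gradedPiece_mono K Ideal.mul_le_right j), Nat.sub_self]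
  rintro f ⟨hf, hfj⟩
  refine ⟨?_, hfj⟩
  obtain ⟨a, ha, c, hc, rfl⟩ := Submodule.mem_sup.mp hf
  change _ ∈ irrelevantIdeal K n * _
  rw [← MvPolynomial.homogeneousComponent_eq_self hfj, map_add, Ideal.mul_sup]
  rcases lt_or_gt_of_ne hj2 with hlt | hgt
  · have ha0 := homogeneousComponent_eq_zero_of_mem_pow (quadIdeal_le_pow K n d ha) hlt
    have hc0 := homogeneousComponent_eq_zero_of_mem_pow (cubIdeal_le_pow K n d hc)
      (show j < 3 by omega)
    rw [ha0, hc0, add_zero]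
    exact Ideal.zero_mem _
  · exact Submodule.add_mem_sup ((homogeneousComponent_mem_of_mem_quadIdeal ha).2 j hgt)
      ((homogeneousComponent_mem_of_mem_cubIdeal hc).2 j (by omega))

end MinimalGenerators

theorem stmt12 (K : Type*) [Field K] [IsAlgClosed K] (n d : ℕ)
    (hd : 2 ≤ d) (hdn : d < n) (hchar : CharZero K ∨ d = 3) :
    minGens K n (kalmanIdeal K n d (d - 1)) 2 = d.choose 2 * (n - d).choose 2 ∧
    minGens K n (kalmanIdeal K n d (d - 1)) 3 = d.choose 2 * (n - d + 1).choose 2 ∧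
    (∀ j : ℕ, j ≠ 2 → j ≠ 3 → minGens K n (kalmanIdeal K n d (d - 1)) j = 0) := by
  have : Infinite K := IsAlgClosed.instInfinite
  rw [kalmanIdeal_eq K hd hdn.le]
  exact ⟨minGens_two K hdn.le, minGens_three K hdn.le, fun j => minGens_eq_zero K⟩
end

section
/- Let K be an algebraically closed field of characteristic 0, d ≥ 1, and n = d + 1. Then the vanishing ideal I_{1,d,d+1} of the Kalman variety K_{1,d,d+1} is a principal ideal of A, generated by a single irreducible homogeneous polynomial of degree d(d+1)/2; in particular K_{1,d,d+1} is an irreducible hypersurface in the space of (d+1)×(d+1) matrices. -/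
set_option synthInstance.maxHeartbeats 1000000
set_option maxHeartbeats 4000000

open Matrix

open MvPolynomial in
/-- The determinant of the generic reduced Kalman matrix with rows `γ, γα, …, γα^{d-1}`
in the case `n = d + 1`. -/
noncomputable def genericKalmanDet (K : Type*) [Field K] (d : ℕ) : MatCoordRing K (d + 1) :=
  Matrix.det (Matrix.of fun i j : Fin d =>
    ((fun k : Fin d => (X (Fin.last d, k.castSucc) : MatCoordRing K (d + 1))) ᵥ*
      (Matrix.of fun k l : Fin d =>
        (X (k.castSucc, l.castSucc) : MatCoordRing K (d + 1))) ^ (i : ℕ)) j)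

theorem map_genericKalmanDet {K R : Type*} [Field K] [CommRing R] {d : ℕ}
    (φ : MatCoordRing K (d + 1) →+* R) :
    φ (genericKalmanDet K d) = Matrix.det (Matrix.of fun i j : Fin d =>
      ((fun k : Fin d => φ (MvPolynomial.X (Fin.last d, k.castSucc))) ᵥ*
        (Matrix.of fun k l : Fin d =>
          φ (MvPolynomial.X (k.castSucc, l.castSucc))) ^ (i : ℕ)) j) := by
  rw [genericKalmanDet, RingHom.map_det]
  congr 1
  ext i j
  simp only [RingHom.mapMatrix_apply, Matrix.map_apply, Matrix.of_apply, RingHom.map_vecMul]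
  rw [Matrix.map_pow]
  rfl

theorem genericKalmanDet_isHomogeneous (K : Type*) [Field K] (d : ℕ) :
    (genericKalmanDet K d).IsHomogeneous (d * (d + 1) / 2) := by
  have entry : ∀ (i : ℕ) (j : Fin d),
      (((fun k : Fin d => (MvPolynomial.X (Fin.last d, k.castSucc) : MatCoordRing K (d + 1))) ᵥ*
        (Matrix.of fun k l : Fin d =>
          (MvPolynomial.X (k.castSucc, l.castSucc) : MatCoordRing K (d + 1))) ^ i) j).IsHomogeneous
        (i + 1) := by
    intro i
    induction i with
    | zero =>
      intro j
      simpa using MvPolynomial.isHomogeneous_X K (Fin.last d, j.castSucc)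
    | succ i ih =>
      intro j
      rw [pow_succ, ← Matrix.vecMul_vecMul]
      simp only [Matrix.vecMul, dotProduct] at ih ⊢
      refine MvPolynomial.IsHomogeneous.sum _ _ _ fun k _ => ?_
      exact (ih k).mul (MvPolynomial.isHomogeneous_X K _)
  have degree : ∑ i : Fin d, ((i : ℕ) + 1) = d * (d + 1) / 2 := by
    rw [Fin.sum_univ_eq_sum_range (fun i => i + 1) d]
    have := Finset.sum_range_succ' (fun i => i) d
    rw [add_zero, Finset.sum_range_id, Nat.add_sub_cancel, mul_comm] at this
    exact this.symm
  rw [genericKalmanDet, Matrix.det_apply]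
  refine MvPolynomial.IsHomogeneous.sum _ _ _ fun σ _ => ?_
  rw [← degree, ← Equiv.sum_comp σ]
  have := MvPolynomial.IsHomogeneous.prod Finset.univ _ _
    fun (i : Fin d) _ => entry (σ i : ℕ) i
  rcases Int.units_eq_one_or (Equiv.Perm.sign σ) with h | h
  · rw [h, one_smul]; exact this
  · rw [h, Units.neg_smul, one_smul]; exact this.neg

theorem mem_kalmanSet_one_iff {K : Type*} [Field K] {d : ℕ}
    {M : Matrix (Fin (d + 1)) (Fin (d + 1)) K} :
    M ∈ kalmanSet K (d + 1) d 1 ↔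
      ∃ v : Fin (d + 1) → K, v ≠ 0 ∧ v (Fin.last d) = 0 ∧ ∃ μ : K, M *ᵥ v = μ • v := by
  constructor
  · rintro ⟨U, hU, hrank, hinv⟩
    obtain ⟨⟨v, hv⟩, hv0, hspan⟩ := finrank_eq_one_iff'.1 hrank
    refine ⟨v, fun h => hv0 (Subtype.ext h), hU hv _ (by simp), ?_⟩
    obtain ⟨c, hc⟩ := hspan ⟨M *ᵥ v, hinv v hv⟩
    exact ⟨c, (congrArg Subtype.val hc).symm⟩
  · rintro ⟨v, hv0, hlast, μ, hμ⟩
    refine ⟨K ∙ v, ?_, finrank_span_singleton hv0, ?_⟩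
    · rw [Submodule.span_singleton_le_iff_mem]
      intro i hi
      have : i = Fin.last d := Fin.ext (by simp; omega)
      rw [this, hlast]
    · intro w hw
      obtain ⟨c, rfl⟩ := Submodule.mem_span_singleton.1 hw
      rw [Matrix.mulVec_smul, hμ]
      exact Submodule.smul_mem _ _ (Submodule.smul_mem _ _ (Submodule.mem_span_singleton_self v))

/-- The eigenvector in `L` can be written in terms of the blocks `α` and `γ`. -/
theorem mem_kalmanSet_one_iff_blocks {K : Type*} [Field K] {d : ℕ}
    {M : Matrix (Fin (d + 1)) (Fin (d + 1)) K} :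
    M ∈ kalmanSet K (d + 1) d 1 ↔ ∃ w : Fin d → K, w ≠ 0 ∧
      (fun k : Fin d => M (Fin.last d) k.castSucc) ⬝ᵥ w = 0 ∧
      ∃ μ : K, (Matrix.of fun k l : Fin d => M k.castSucc l.castSucc) *ᵥ w = μ • w := by
  rw [mem_kalmanSet_one_iff]
  constructor
  · rintro ⟨v, hv0, hlast, μ, hμ⟩
    refine ⟨fun k => v k.castSucc, fun h => hv0 ?_, ?_, μ, ?_⟩
    · ext i
      refine Fin.lastCases hlast (fun k => congrFun h k) i
    · have := congrFun hμ (Fin.last d)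
      simpa [Matrix.mulVec, dotProduct, Fin.sum_univ_castSucc, hlast] using this
    · ext k
      have := congrFun hμ k.castSucc
      simpa [Matrix.mulVec, dotProduct, Fin.sum_univ_castSucc, hlast] using this
  · rintro ⟨w, hw0, hγ, μ, hμ⟩
    refine ⟨Fin.snoc w 0, fun h => hw0 ?_, by simp, μ, ?_⟩
    · ext k
      simpa using congrFun h k.castSucc
    · ext i
      refine Fin.lastCases ?_ (fun k => ?_) i
      · simpa [Matrix.mulVec, dotProduct, Fin.sum_univ_castSucc] using hγ
      · have := congrFun hμ k
        simpa [Matrix.mulVec, dotProduct, Fin.sum_univ_castSucc] using this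

theorem pow_mulVec_of_mulVec_eq_smul {K ι : Type*} [Field K] [Fintype ι] [DecidableEq ι]
    {α : Matrix ι ι K} {w : ι → K} {μ : K} (h : α *ᵥ w = μ • w) (i : ℕ) :
    α ^ i *ᵥ w = μ ^ i • w := by
  induction i with
  | zero => simp
  | succ i ih =>
    rw [pow_succ, ← Matrix.mulVec_mulVec, h, Matrix.mulVec_smul, ih, smul_smul, pow_succ']

/-- The Hautus test over an algebraically closed field: the observability matrix of `(α, γ)` is
singular if and only if `α` has an eigenvector annihilated by `γ`. -/
theorem det_vecMul_pow_eq_zero_iff {K : Type*} [Field K] [IsAlgClosed K] {d : ℕ}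
    (α : Matrix (Fin d) (Fin d) K) (γ : Fin d → K) :
    Matrix.det (Matrix.of fun i j : Fin d => (γ ᵥ* α ^ (i : ℕ)) j) = 0 ↔
      ∃ w : Fin d → K, w ≠ 0 ∧ γ ⬝ᵥ w = 0 ∧ ∃ μ : K, α *ᵥ w = μ • w := by
  have row : ∀ (w : Fin d → K) (i : Fin d),
      ((Matrix.of fun i j : Fin d => (γ ᵥ* α ^ (i : ℕ)) j) *ᵥ w) i = γ ⬝ᵥ (α ^ (i : ℕ) *ᵥ w) := by
    intro w i
    rw [Matrix.dotProduct_mulVec]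
    rfl
  rw [← Matrix.exists_mulVec_eq_zero_iff]
  constructor
  · rintro ⟨v, hv0, hv⟩
    have hlt : ∀ i < d, γ ⬝ᵥ (α ^ i *ᵥ v) = 0 := fun i hi => by
      rw [← row v ⟨i, hi⟩, hv]; rfl
    have hall : ∀ i : ℕ, γ ⬝ᵥ (α ^ i *ᵥ v) = 0 := by
      intro i
      rw [Matrix.pow_eq_aeval_mod_charpoly, Polynomial.aeval_eq_sum_range, Matrix.sum_mulVec,
        dotProduct_sum]
      refine Finset.sum_eq_zero fun k hk => ?_
      rw [Matrix.smul_mulVec, dotProduct_smul]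
      by_cases hkd : k < d
      · rw [hlt k hkd, smul_zero]
      · rw [Polynomial.coeff_eq_zero_of_degree_lt, zero_smul]
        refine (Polynomial.degree_modByMonic_lt _ (Matrix.charpoly_monic α)).trans_le ?_
        rw [Matrix.charpoly_degree_eq_dim, Fintype.card_fin]
        exact_mod_cast not_lt.1 hkd
    let W : Submodule K (Fin d → K) :=
      { carrier := {w | ∀ i : ℕ, γ ⬝ᵥ (α ^ i *ᵥ w) = 0}
        add_mem' := fun ha hb i => by rw [Matrix.mulVec_add, dotProduct_add, ha i, hb i, add_zero]
        zero_mem' := fun i => by simp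
        smul_mem' := fun c w hw i => by rw [Matrix.mulVec_smul, dotProduct_smul, hw i, smul_zero] }
    have hinv : ∀ w ∈ W, Matrix.toLin' α w ∈ W := fun w hw i => by
      rw [Matrix.toLin'_apply, Matrix.mulVec_mulVec, ← pow_succ]
      exact hw (i + 1)
    have : Nontrivial W := ⟨⟨v, hall⟩, 0, fun h => hv0 (congrArg Subtype.val h)⟩
    obtain ⟨μ, hμ⟩ := Module.End.exists_eigenvalue ((Matrix.toLin' α).restrict hinv)
    obtain ⟨w, hw⟩ := hμ.exists_hasEigenvector
    refine ⟨w, fun h => hw.2 (Subtype.ext h), by simpa using w.2 0, μ, ?_⟩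
    simpa using congrArg Subtype.val hw.apply_eq_smul
  · rintro ⟨w, hw0, hγ, μ, hμ⟩
    refine ⟨w, hw0, ?_⟩
    ext i
    rw [row, pow_mulVec_of_mulVec_eq_smul hμ, dotProduct_smul, hγ, smul_zero]
    rfl

theorem eval_genericKalmanDet_eq_zero_iff {K : Type*} [Field K] [IsAlgClosed K] {d : ℕ}
    (M : Matrix (Fin (d + 1)) (Fin (d + 1)) K) :
    MvPolynomial.eval (fun p => M p.1 p.2) (genericKalmanDet K d) = 0 ↔
      M ∈ kalmanSet K (d + 1) d 1 := by
  rw [map_genericKalmanDet, mem_kalmanSet_one_iff_blocks, ← det_vecMul_pow_eq_zero_iff]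
  simp only [MvPolynomial.eval_X]

theorem eval_aeval_matrix {K : Type*} [Field K] {n : ℕ}
    (N : Matrix (Fin n) (Fin n) (Polynomial K)) (t : K) (g : MatCoordRing K n) :
    (MvPolynomial.aeval (fun p => N p.1 p.2) g).eval t =
      MvPolynomial.eval (fun p => N.map (Polynomial.eval t) p.1 p.2) g := by
  induction g using MvPolynomial.induction_on with
  | C a => simp
  | add p q hp hq => simp only [map_add, Polynomial.eval_add, hp, hq]
  | mul_X p i hp => simp [hp]

theorem exists_dotProduct_ne_zero_of_ne_zero {K ι : Type*} [Field K] [Fintype ι]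
    {v w : ι → K} (hv : v ≠ 0) (hw : w ≠ 0) : ∃ l : ι → K, l ⬝ᵥ v ≠ 0 ∧ l ⬝ᵥ w ≠ 0 := by
  classical
  obtain ⟨i, hi⟩ := Function.ne_iff.1 hv
  obtain ⟨j, hj⟩ := Function.ne_iff.1 hw
  by_cases hwi : w i = 0
  · by_cases hvj : v j = 0
    · exact ⟨Pi.single i 1 + Pi.single j 1, by simpa [hvj] using hi, by simpa [hwi] using hj⟩
    · exact ⟨Pi.single j 1, by simpa using hvj, by simpa using hj⟩
  · exact ⟨Pi.single i 1, by simpa using hi, by simpa using hwi⟩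

theorem exists_eigenvector_dotProduct_eq_one {K : Type*} [Field K] {d : ℕ}
    {M : Matrix (Fin (d + 1)) (Fin (d + 1)) K} {l v : Fin (d + 1) → K} {μ : K}
    (hl : l ⬝ᵥ v ≠ 0) (hlast : v (Fin.last d) = 0) (hμ : M *ᵥ v = μ • v) :
    ∃ w : Fin (d + 1) → K, l ⬝ᵥ w = 1 ∧ w (Fin.last d) = 0 ∧ M *ᵥ w = μ • w :=
  ⟨(l ⬝ᵥ v)⁻¹ • v, by rw [dotProduct_smul, smul_eq_mul, inv_mul_cancel₀ hl], by simp [hlast],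
    by rw [Matrix.mulVec_smul, hμ, smul_comm]⟩

/-- Any two points of `K_{1,d,d+1}` lie on a polynomial curve contained in `K_{1,d,d+1}`. -/
theorem exists_curve_kalmanSet {K : Type*} [Field K] {d : ℕ}
    {M₁ M₂ : Matrix (Fin (d + 1)) (Fin (d + 1)) K}
    (h₁ : M₁ ∈ kalmanSet K (d + 1) d 1) (h₂ : M₂ ∈ kalmanSet K (d + 1) d 1) :
    ∃ N : Matrix (Fin (d + 1)) (Fin (d + 1)) (Polynomial K),
      N.map (Polynomial.eval 0) = M₁ ∧ N.map (Polynomial.eval 1) = M₂ ∧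
      ∀ t, N.map (Polynomial.eval t) ∈ kalmanSet K (d + 1) d 1 := by
  obtain ⟨v₁', hv₁, hlast₁', μ₁, hμ₁'⟩ := mem_kalmanSet_one_iff.1 h₁
  obtain ⟨v₂', hv₂, hlast₂', μ₂, hμ₂'⟩ := mem_kalmanSet_one_iff.1 h₂
  obtain ⟨l, hl₁', hl₂'⟩ := exists_dotProduct_ne_zero_of_ne_zero hv₁ hv₂
  obtain ⟨v₁, hl₁, hlast₁, hμ₁⟩ := exists_eigenvector_dotProduct_eq_one hl₁' hlast₁' hμ₁'
  obtain ⟨v₂, hl₂, hlast₂, hμ₂⟩ := exists_eigenvector_dotProduct_eq_one hl₂' hlast₂' hμ₂'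
  let path : K → K → Polynomial K := fun a b =>
    (1 - Polynomial.X) * Polynomial.C a + Polynomial.X * Polynomial.C b
  let N₀ : Matrix (Fin (d + 1)) (Fin (d + 1)) (Polynomial K) :=
    Matrix.of fun i j => path (M₁ i j) (M₂ i j)
  let v : Fin (d + 1) → Polynomial K := fun i => path (v₁ i) (v₂ i)
  let N : Matrix (Fin (d + 1)) (Fin (d + 1)) (Polynomial K) :=
    N₀ + Matrix.vecMulVec (path μ₁ μ₂ • v - N₀ *ᵥ v) (fun i => Polynomial.C (l i))
  have hN : ∀ t, N.map (Polynomial.eval t) = ((1 - t) • M₁ + t • M₂) +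
      Matrix.vecMulVec (((1 - t) * μ₁ + t * μ₂) • ((1 - t) • v₁ + t • v₂) -
        ((1 - t) • M₁ + t • M₂) *ᵥ ((1 - t) • v₁ + t • v₂)) l := by
    intro t
    ext i j
    simp [N, N₀, v, path, Matrix.vecMulVec, Matrix.mulVec, dotProduct, Polynomial.eval_finsetSum]
    simp only [mul_comm _ t]
    ring
  refine ⟨N, ?_, ?_, fun t => ?_⟩
  · rw [hN]; simp [hμ₁]
  · rw [hN]; simp [hμ₂]
  · rw [hN, mem_kalmanSet_one_iff]
    have hl : l ⬝ᵥ ((1 - t) • v₁ + t • v₂) = 1 := by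
      rw [dotProduct_add, dotProduct_smul, dotProduct_smul, hl₁, hl₂]; simp
    refine ⟨(1 - t) • v₁ + t • v₂, fun h => ?_, by simp [hlast₁, hlast₂],
      (1 - t) * μ₁ + t * μ₂, ?_⟩
    · rw [h] at hl; simp at hl
    · rw [Matrix.add_mulVec, Matrix.vecMulVec_mulVec, hl]
      simp

/-- The image of the generic Kalman determinant on the line `α = diag(0, …, d)`,
`γ = (t, 1, …, 1)`. -/
theorem exists_line_kalman (K : Type*) [Field K] [IsAlgClosed K] [CharZero K]
    {d : ℕ} (hd : 1 ≤ d) :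
    ∃ N : Matrix (Fin (d + 1)) (Fin (d + 1)) (Polynomial K),
      N.map (Polynomial.eval 0) ∈ kalmanSet K (d + 1) d 1 ∧
      ∃ c : K, c ≠ 0 ∧ MvPolynomial.aeval (fun p => N p.1 p.2) (genericKalmanDet K d) =
        Polynomial.X * Polynomial.C c := by
  obtain ⟨e, rfl⟩ : ∃ e, d = e + 1 := ⟨d - 1, by omega⟩
  let γ : Fin (e + 1) → Polynomial K := Fin.cons Polynomial.X fun _ => 1
  let τ : Fin (e + 1) → K := fun i => (i : ℕ)
  let N : Matrix (Fin (e + 1 + 1)) (Fin (e + 1 + 1)) (Polynomial K) :=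
    Fin.snoc (fun k => Fin.snoc (Matrix.diagonal (fun i => Polynomial.C (τ i)) k) 0)
      (Fin.snoc γ 0)
  have hdet : MvPolynomial.aeval (fun p => N p.1 p.2) (genericKalmanDet K (e + 1)) =
      Polynomial.X * Polynomial.C (Matrix.vandermonde τ).det := by
    have := map_genericKalmanDet (K := K) (d := e + 1)
      (MvPolynomial.aeval (fun p => N p.1 p.2)).toRingHom
    rw [AlgHom.toRingHom_eq_coe, RingHom.coe_coe] at this
    rw [this]
    have hM : (Matrix.of fun k l : Fin (e + 1) => N k.castSucc l.castSucc) =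
        Matrix.diagonal (fun i => Polynomial.C (τ i)) := by
      ext1 k l
      simp [N]
    have hγ : (fun k : Fin (e + 1) => N (Fin.last _) k.castSucc) = γ := by
      ext1 k
      simp [N]
    simp only [MvPolynomial.aeval_X, hM, hγ, Matrix.diagonal_pow, Matrix.vecMul_diagonal]
    have hfac : (Matrix.of fun i j : Fin (e + 1) =>
        γ j * ((fun i => Polynomial.C (τ i)) ^ (i : ℕ)) j) =
        ((Matrix.vandermonde τ).map Polynomial.C)ᵀ * Matrix.diagonal γ := by
      ext1 i j
      rw [Matrix.mul_diagonal]
      simp [Matrix.vandermonde_apply, mul_comm]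
    rw [hfac, Matrix.det_mul, Matrix.det_transpose, Matrix.det_diagonal, mul_comm,
      Fin.prod_univ_succ, RingHom.map_det]
    simp [γ]
  refine ⟨N, ?_, _, ?_, hdet⟩
  · rw [← eval_genericKalmanDet_eq_zero_iff, ← eval_aeval_matrix, hdet]
    simp
  · rw [Matrix.det_vandermonde_ne_zero_iff]
    intro i j h
    exact Fin.ext (Nat.cast_injective h)

theorem kalmanIdeal_one_isPrime (K : Type*) [Field K] [IsAlgClosed K] [CharZero K]
    {d : ℕ} (hd : 1 ≤ d) : (kalmanIdeal K (d + 1) d 1).IsPrime := by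
  refine ⟨fun htop => ?_, fun {g h} hgh => ?_⟩
  · obtain ⟨N, hN, -⟩ := exists_line_kalman K hd
    have : (1 : MatCoordRing K (d + 1)) ∈ kalmanIdeal K (d + 1) d 1 := htop ▸ Submodule.mem_top
    simpa using this _ hN
  · by_contra! hcon
    obtain ⟨hg, hh⟩ := hcon
    obtain ⟨M₁, hM₁, hgM⟩ : ∃ M ∈ kalmanSet K (d + 1) d 1,
        MvPolynomial.eval (fun p => M p.1 p.2) g ≠ 0 := by
      by_contra! H; exact hg H
    obtain ⟨M₂, hM₂, hhM⟩ : ∃ M ∈ kalmanSet K (d + 1) d 1,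
        MvPolynomial.eval (fun p => M p.1 p.2) h ≠ 0 := by
      by_contra! H; exact hh H
    obtain ⟨N, rfl, rfl, hN⟩ := exists_curve_kalmanSet hM₁ hM₂
    rw [← eval_aeval_matrix] at hgM hhM
    have hzero : MvPolynomial.aeval (fun p => N p.1 p.2) (g * h) = 0 := by
      refine Polynomial.funext fun t => ?_
      rw [eval_aeval_matrix, hgh _ (hN t), Polynomial.eval_zero]
    rw [map_mul, mul_eq_zero] at hzero
    rcases hzero with h0 | h0
    · rw [h0] at hgM; simp at hgM
    · rw [h0] at hhM; simp at hhM

theorem kalmanIdeal_one_eq_radical (K : Type*) [Field K] [IsAlgClosed K] (d : ℕ) :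
    kalmanIdeal K (d + 1) d 1 = (Ideal.span {genericKalmanDet K d}).radical := by
  rw [← MvPolynomial.vanishingIdeal_zeroLocus_eq_radical (K := K)]
  ext g
  rw [MvPolynomial.mem_vanishingIdeal_iff, MvPolynomial.zeroLocus_span]
  constructor
  · intro hg x hx
    refine hg (Matrix.of fun i j => x (i, j)) ((eval_genericKalmanDet_eq_zero_iff _).1 ?_)
    exact hx _ rfl
  · intro hg M hM
    refine hg (fun p => M p.1 p.2) ?_
    rintro _ rfl
    exact (eval_genericKalmanDet_eq_zero_iff M).2 hM

theorem genericKalmanDet_irreducible (K : Type*) [Field K] [IsAlgClosed K] [CharZero K]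
    {d : ℕ} (hd : 1 ≤ d) : Irreducible (genericKalmanDet K d) := by
  obtain ⟨N, hN, c, hc, hline⟩ := exists_line_kalman K hd
  have hprime := kalmanIdeal_one_isPrime K hd
  have hrad := kalmanIdeal_one_eq_radical K d
  have hne : genericKalmanDet K d ≠ 0 := by
    intro h
    rw [h, map_zero] at hline
    simp [hc] at hline
  have hmem : genericKalmanDet K d ∈ kalmanIdeal K (d + 1) d 1 :=
    hrad ▸ Ideal.le_radical (Ideal.mem_span_singleton_self _)
  have hX : ∀ g ∈ kalmanIdeal K (d + 1) d 1,
      Polynomial.X ∣ MvPolynomial.aeval (fun p => N p.1 p.2) g := by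
    intro g hg
    rw [Polynomial.X_dvd_iff, Polynomial.coeff_zero_eq_eval_zero, eval_aeval_matrix, hg _ hN]
  obtain ⟨p, hp, hpI⟩ : ∃ p ∈ UniqueFactorizationMonoid.factors (genericKalmanDet K d),
      p ∈ kalmanIdeal K (d + 1) d 1 := by
    have hprod : (UniqueFactorizationMonoid.factors (genericKalmanDet K d)).prod ∈
        kalmanIdeal K (d + 1) d 1 := by
      obtain ⟨u, hu⟩ := UniqueFactorizationMonoid.factors_prod hne
      rw [← hu] at hmem
      exact (hprime.mem_or_mem hmem).resolve_right
        fun h => hprime.ne_top (Ideal.eq_top_of_isUnit_mem _ h u.isUnit)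
    exact (hprime.multiset_prod_mem_iff_exists_mem _).1 hprod
  obtain ⟨h, hh⟩ := UniqueFactorizationMonoid.dvd_of_mem_factors hp
  have hpprime := UniqueFactorizationMonoid.prime_of_factor p hp
  have hunit : IsUnit h := by
    obtain ⟨m, hm⟩ : ∃ m : ℕ, p ^ m ∈ Ideal.span {genericKalmanDet K d} := by
      rw [hrad] at hpI; exact hpI
    have hdvd : h ∣ p ^ m := (Dvd.intro_left p hh.symm).trans (Ideal.mem_span_singleton.1 hm)
    obtain ⟨j, -, hj⟩ := (dvd_prime_pow hpprime m).1 hdvd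
    rcases Nat.eq_zero_or_pos j with rfl | hj0
    · rw [pow_zero] at hj
      exact associated_one_iff_isUnit.1 hj
    · exfalso
      have hhI : h ∈ kalmanIdeal K (d + 1) d 1 := by
        refine Ideal.mem_of_dvd _ hj.symm.dvd (Ideal.pow_mem_of_mem _ hpI j hj0)
      have := mul_dvd_mul (hX p hpI) (hX h hhI)
      rw [← map_mul, ← hh, hline] at this
      have := (mul_dvd_mul_iff_left Polynomial.X_ne_zero).1 this
      rw [Polynomial.X_dvd_iff, Polynomial.coeff_C_zero] at this
      exact hc this
  have hassoc : Associated p (genericKalmanDet K d) := ⟨hunit.unit, hh.symm⟩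
  exact hassoc.irreducible_iff.1 hpprime.irreducible

theorem stmt19 (K : Type*) [Field K] [IsAlgClosed K] [CharZero K]
    (d : ℕ) (hd : 1 ≤ d) :
    ∃ f : MatCoordRing K (d + 1),
      Irreducible f ∧ f.IsHomogeneous (d * (d + 1) / 2) ∧
      kalmanIdeal K (d + 1) d 1 = Ideal.span {f} := by
  have hirr := genericKalmanDet_irreducible K hd
  refine ⟨genericKalmanDet K d, hirr, genericKalmanDet_isHomogeneous K d, ?_⟩
  rw [kalmanIdeal_one_eq_radical]
  exact ((Ideal.span_singleton_prime hirr.ne_zero).2 hirr.prime).isRadical.radical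
end
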